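/- For every β > (ln 3)/2 and h = 0, there exists n₀ such that for all n ≥ n₀, ν_{β,0}^+( η_i = −1 for all i ∈ {−n,…,−1} ) ≤ 2^{−n}. -/

import Mathlib

open MeasureTheory Filter Topology ProbabilityTheory

noncomputable section

/-- Spin value of a Boolean spin: `true ↦ +1`, `false ↦ -1`. -/
def sval (b : Bool) : ℝ := if b then 1 else -1

/-- Two-dimensional spin configurations. -/
abbrev Cfg2 := ℤ × ℤ → Bool

/-- Two-sided sequences over an alphabet `A`. -/
abbrev ZSeq (A : Type*) := ℤ → A

/-- Pasts: index `k` corresponds to the coordinate `-(k+1)`. -/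
abbrev Past (A : Type*) := ℕ → A

/-- The four nearest neighbours of a site of `ℤ²`. -/
def nbrs (x : ℤ × ℤ) : Finset (ℤ × ℤ) :=
  {(x.1 + 1, x.2), (x.1 - 1, x.2), (x.1, x.2 + 1), (x.1, x.2 - 1)}

/-- Boltzmann weight
`exp(β[Σ_{{x,y}⊆Λ, x∼y} ω_x ω_y + Σ_{x∈Λ, y∉Λ, x∼y} ω_x σ_y] − h Σ_{x∈Λ} ω_x)`
(the sum over unordered pairs inside `Λ` is written as half the ordered sum). -/
def isingWeight (β h : ℝ) (Λ : Finset (ℤ × ℤ)) (σ ω : Cfg2) : ℝ :=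
  Real.exp (β * ((∑ x ∈ Λ, ∑ y ∈ Λ.filter (fun y => y ∈ nbrs x),
        sval (ω x) * sval (ω y)) / 2
      + ∑ x ∈ Λ, ∑ y ∈ (nbrs x).filter (fun y => y ∉ Λ), sval (ω x) * sval (σ y))
    - h * ∑ x ∈ Λ, sval (ω x))

/-- Fill in the values `τ` inside `Λ` and `σ` outside. -/
def fill (Λ : Finset (ℤ × ℤ)) (σ : Cfg2) (τ : ↥Λ → Bool) : Cfg2 :=
  fun x => if hx : x ∈ Λ then τ ⟨x, hx⟩ else σ x

/-- The finite-volume Ising measure in `Λ` with boundary condition `σ`, viewed as a measure on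
the full configuration space, the spins outside `Λ` being frozen to `σ`. -/
def isingFV (β h : ℝ) (Λ : Finset (ℤ × ℤ)) (σ : Cfg2) : Measure Cfg2 :=
  (∑ τ : ↥Λ → Bool, ENNReal.ofReal (isingWeight β h Λ σ (fill Λ σ τ)))⁻¹ •
    ∑ τ : ↥Λ → Bool,
      ENNReal.ofReal (isingWeight β h Λ σ (fill Λ σ τ)) • Measure.dirac (fill Λ σ τ)

/-- The box `[-n,n]²`. -/
def box (n : ℕ) : Finset (ℤ × ℤ) :=
  (Finset.Icc (-(n : ℤ)) (n : ℤ)) ×ˢ (Finset.Icc (-(n : ℤ)) (n : ℤ))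

/-- Convergence of a sequence of measures on a product space in the sense of convergence of the
measures of all finite-dimensional cylinder events; for probability measures on `{−1,+1}^ι`
this is exactly weak convergence. -/
def CylTendsto {ι A : Type*} [MeasurableSpace A] (μs : ℕ → Measure (ι → A))
    (μ : Measure (ι → A)) : Prop :=
  ∀ (s : Finset ι) (f : ι → A),
    Tendsto (fun n => μs n {η | ∀ i ∈ s, η i = f i}) atTop (𝓝 (μ {η | ∀ i ∈ s, η i = f i}))

/-- `μ` is the plus phase `μ_{β,h}^+`: the weak limit of the finite-volume Ising measures on
`[-n,n]²` with all-plus boundary conditions. -/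
def IsPlusPhase (β h : ℝ) (μ : Measure Cfg2) : Prop :=
  IsProbabilityMeasure μ ∧ CylTendsto (fun n => isingFV β h (box n) (fun _ => true)) μ

/-- `μ` is the minus phase `μ_{β,h}^-`. -/
def IsMinusPhase (β h : ℝ) (μ : Measure Cfg2) : Prop :=
  IsProbabilityMeasure μ ∧ CylTendsto (fun n => isingFV β h (box n) (fun _ => false)) μ

/-- The critical inverse temperature `β_c = ln(1+√2)/2`. -/
def betaCrit : ℝ := Real.log (1 + Real.sqrt 2) / 2

/-- Projection of a two-dimensional configuration onto the line `ℤ × {0}`. -/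
def lineProj (η : Cfg2) : ZSeq Bool := fun i => η (i, 0)

/-- The Schonmann projection of a measure on `{−1,+1}^{ℤ²}`. -/
def schonmann (μ : Measure Cfg2) : Measure (ZSeq Bool) := μ.map lineProj

/-- Restriction of a two-sided sequence to its strict past; index `k` is coordinate `-(k+1)`. -/
def restrictPast {A : Type*} (ω : ZSeq A) : Past A := fun k => ω (-(k + 1 : ℤ))

/-- The shift on two-sided sequences. -/
def shiftSeq {A : Type*} : ZSeq A → ZSeq A := fun ω i => ω (i + 1)

/-- The σ-algebra `ℱ_{<0}` generated by the coordinates of negative index. -/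
def pastSigma (A : Type*) [MeasurableSpace A] : MeasurableSpace (ZSeq A) :=
  MeasurableSpace.comap (fun ω : ZSeq A => restrictPast ω) inferInstance

/-- The σ-algebra generated by the coordinates in `S`. -/
def sigmaOn {ι A : Type*} [MeasurableSpace A] (S : Set ι) : MeasurableSpace (ι → A) :=
  MeasurableSpace.comap (fun ω : ι → A => S.restrict ω) inferInstance

/-- A g-function on the alphabet `A`: measurable, `[0,1]`-valued, normalized. -/
def IsGFunction {A : Type*} [Fintype A] [MeasurableSpace A] (P : A → Past A → ℝ) : Prop :=
  (∀ a, Measurable (P a)) ∧ ∀ ω, (∑ a : A, P a ω) = 1 ∧ ∀ a, P a ω ∈ Set.Icc (0 : ℝ) 1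

/-- `μ` is a translation-invariant g-measure consistent with the g-function `P`: for each `a`,
`ω ↦ P a (restrictPast ω)` is a version of the conditional probability `μ(X₀ = a | ℱ_{<0})`. -/
def IsGMeasure {A : Type*} [MeasurableSpace A] (μ : Measure (ZSeq A))
    (P : A → Past A → ℝ) : Prop :=
  IsProbabilityMeasure μ ∧ μ.map shiftSeq = μ ∧
    ∀ a : A, (fun ω => P a (restrictPast ω))
      =ᵐ[μ] μ[Set.indicator {ω : ZSeq A | ω 0 = a} (fun _ => (1 : ℝ)) | pastSigma A]

/-- The `k`-th variation of a g-function: the supremum of `|P a ω − P a σ|` over pasts agreeing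
on the coordinates `−k,…,−1`. -/
def varG {A : Type*} (P : A → Past A → ℝ) (k : ℕ) : ℝ :=
  sSup {d : ℝ | ∃ (a : A) (ω σ' : Past A), (∀ j < k, ω j = σ' j) ∧ d = |P a ω - P a σ'|}

/-- Elementary conditional probability `μ(B | A)`, as a real number. -/
def condProbR {X : Type*} [MeasurableSpace X] (μ : Measure X) (B A : Set X) : ℝ :=
  ((μ[|A]) B).toReal

/-- The event that `η_i = ω` (suitably reindexed) for `−n ≤ i ≤ −1` and `η_i = b`
for `−(n+l) ≤ i ≤ −(n+1)`. -/
def pastEvt (n l : ℕ) (b : Bool) (ω : Past Bool) : Set (ZSeq Bool) :=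
  {η | (∀ i : ℤ, -(n : ℤ) ≤ i → i ≤ -1 → η i = ω (i.natAbs - 1)) ∧
       (∀ i : ℤ, -((n : ℤ) + l) ≤ i → i ≤ -((n : ℤ) + 1) → η i = b)}

/-- The event that `η_i = b` for `−(n+l) ≤ i ≤ −n`. -/
def blockEvt (n l : ℕ) (b : Bool) : Set (ZSeq Bool) :=
  {η | ∀ i : ℤ, -((n : ℤ) + l) ≤ i → i ≤ -(n : ℤ) → η i = b}

/-- The event that `η_i = b` for `−n ≤ i ≤ −1`. -/
def allBlock (n : ℕ) (b : Bool) : Set (ZSeq Bool) :=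
  {η | ∀ i : ℤ, -(n : ℤ) ≤ i → i ≤ -1 → η i = b}

/-- `P` is the g-function `P^{+,b}` obtained from `ν` by conditioning on the symbol `b`
in the far past: `P(a|ω) = lim_n lim_l ν(η₀ = a | η = b on [−(n+l),−(n+1)], η = ω on [−n,−1])`,
both iterated limits being required to exist. -/
def IsCondG (ν : Measure (ZSeq Bool)) (b : Bool) (P : Bool → Past Bool → ℝ) : Prop :=
  ∀ (a : Bool) (ω : Past Bool), ∃ L : ℕ → ℝ,
    (∀ n, Tendsto (fun l => condProbR ν {η | η 0 = a} (pastEvt n l b ω)) atTop (𝓝 (L n))) ∧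
    Tendsto L atTop (𝓝 (P a ω))

/-- `ν'` is the iterated weak limit `lim_n lim_l ν( · | η = b on [−(n+l),−n])`. -/
def IsCondLimitMeasure (ν : Measure (ZSeq Bool)) (b : Bool) (ν' : Measure (ZSeq Bool)) : Prop :=
  ∃ νseq : ℕ → Measure (ZSeq Bool),
    (∀ n, CylTendsto (fun l => ν[|blockEvt n l b]) (νseq n)) ∧ CylTendsto νseq ν'

/-- Stochastic domination: `ν ≤ μ` iff `ν B ≤ μ B` for every increasing measurable event `B`. -/
def StochDom {A : Type*} [MeasurableSpace A] [Preorder A]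
    (ν μ : Measure (ZSeq A)) : Prop :=
  ∀ B : Set (ZSeq A), MeasurableSet B → (∀ ⦃x y : ZSeq A⦄, x ≤ y → x ∈ B → y ∈ B) → ν B ≤ μ B

/-- `π` is the i.i.d. product measure with `π(η_i = +1) = ρ` for each coordinate. -/
def IsBernoulliProd (ρ : ℝ) (π : Measure (ZSeq Bool)) : Prop :=
  IsProbabilityMeasure π ∧ ∀ (s : Finset ℤ) (f : ℤ → Bool),
    π {η | ∀ i ∈ s, η i = f i} = ∏ i ∈ s, ENNReal.ofReal (if f i then ρ else 1 - ρ)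

/-- Splicing of pasts: coordinates `−k,…,−1` (indices `< k`) from `ω`, the rest from `σ`. -/
def splice {A : Type*} (σ ω : Past A) (k : ℕ) : Past A := fun j => if j < k then ω j else σ j

/-- `ν'` is an extreme point of the convex set of g-measures consistent with `P`. -/
def ExtremeGMeasure (ν' : Measure (ZSeq Bool)) (P : Bool → Past Bool → ℝ) : Prop :=
  IsGMeasure ν' P ∧
  ∀ ν₁ ν₂ : Measure (ZSeq Bool), IsGMeasure ν₁ P → IsGMeasure ν₂ P →
    ∀ t : ℝ, t ∈ Set.Ioo (0 : ℝ) 1 →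
      ν' = ENNReal.ofReal t • ν₁ + ENNReal.ofReal (1 - t) • ν₂ → ν₁ = ν' ∧ ν₂ = ν'

/-- The event that the spins on the line are `−1` on `{−m,…,−n} × {0}`. -/
def lineMinusEvt (n m : ℕ) : Set Cfg2 :=
  {η | ∀ i : ℤ, -(m : ℤ) ≤ i → i ≤ -(n : ℤ) → η (i, 0) = false}

/-- Nearest-neighbour adjacency in `ℤ²` (`‖x−y‖₁ = 1`). -/
def adj2 (x y : ℤ × ℤ) : Prop := (x.1 - y.1).natAbs + (x.2 - y.2).natAbs = 1

/-- The event `A_n`: there is an infinite nearest-neighbour path of `+1` spins starting at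
`(n,0)` entirely contained in the half-plane `{x ≤ n}`. -/
def plusPathEvt (n : ℕ) : Set Cfg2 :=
  {η | ∃ γ : ℕ → ℤ × ℤ, γ 0 = ((n : ℤ), 0) ∧ (∀ j, adj2 (γ j) (γ (j + 1))) ∧
    Function.Injective γ ∧ (∀ j, (γ j).1 ≤ (n : ℤ)) ∧ ∀ j, η (γ j) = true}

/-- The block map for the decimation `ν_{l,k}`: the `j`-th letter consists of the spins on
`[j(k+l), j(k+l)+l−1]`. -/
def blockMap (l k : ℕ) (η : ZSeq Bool) : ZSeq (Fin l → Bool) :=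
  fun j r => η (j * ((k : ℤ) + l) + r)

end

section PositiveKernels

variable {α : Type*} [Fintype α]

/-- The operator `f ↦ ∑ c', K c c' w c' f c'` with kernel `K` and weight `w`. -/
def weightedOp (K : α → α → ℝ) (w f : α → ℝ) : α → ℝ :=
  fun c => ∑ c', K c c' * w c' * f c'

theorem exists_pos_eigenvector [Nonempty α] (A : α → α → ℝ) (hA : ∀ i j, 0 < A i j) :
    ∃ (l : ℝ) (x : α → ℝ), 0 < l ∧ (∀ i, 0 < x i) ∧ ∀ i, ∑ j, A i j * x j = l * x i := by
  classical
  have applyPos : ∀ x : α → ℝ, (∀ i, 0 ≤ x i) → (∃ i, 0 < x i) → ∀ i, 0 < ∑ j, A i j * x j := by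
    intro x hx ⟨k, hk⟩ i
    exact Finset.sum_pos' (fun j _ => mul_nonneg (hA i j).le (hx j))
      ⟨k, Finset.mem_univ k, mul_pos (hA i k) hk⟩
  let S : Set (ℝ × (α → ℝ)) :=
    (Set.Icc 0 (∑ i, ∑ j, A i j) ×ˢ stdSimplex ℝ α) ∩
      {p | ∀ i, p.1 * p.2 i ≤ ∑ j, A i j * p.2 j}
  have hS : IsCompact S := by
    refine (isCompact_Icc.prod (isCompact_stdSimplex ℝ α)).inter_right ?_
    simp only [Set.ofPred_forall]
    refine isClosed_iInter fun i => isClosed_le ?_ ?_ <;> fun_prop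
  have memS : ∀ (r : ℝ) (x : α → ℝ), 0 ≤ r → x ∈ stdSimplex ℝ α →
      (∀ i, r * x i ≤ ∑ j, A i j * x j) → (r, x) ∈ S := by
    intro r x hr hx h
    refine ⟨⟨⟨hr, ?_⟩, hx⟩, h⟩
    calc r = ∑ i, r * x i := by rw [← Finset.mul_sum, hx.2, mul_one]
      _ ≤ ∑ i, ∑ j, A i j * x j := Finset.sum_le_sum fun i _ => h i
      _ ≤ ∑ i, ∑ j, A i j := by
        refine Finset.sum_le_sum fun i _ => Finset.sum_le_sum fun j _ => ?_
        have : x j ≤ 1 := hx.2 ▸ Finset.single_le_sum (fun k _ => hx.1 k) (Finset.mem_univ j)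
        nlinarith [hA i j]
  obtain ⟨k⟩ := ‹Nonempty α›
  have hne : S.Nonempty := by
    refine ⟨(0, Pi.single k 1), memS 0 _ le_rfl (single_mem_stdSimplex ℝ k) fun i => ?_⟩
    rw [zero_mul]
    refine Finset.sum_nonneg fun j _ => mul_nonneg (hA i j).le ?_
    exact (single_mem_stdSimplex ℝ k).1 j
  obtain ⟨⟨r, x⟩, hrx, hmax⟩ := hS.exists_isMaxOn hne continuous_fst.continuousOn
  obtain ⟨⟨hr, hx⟩, hle⟩ := hrx
  simp only [Set.mem_ofPred_eq] at hr hx hle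
  have hxpos : ∃ i, 0 < x i := by
    by_contra! hcon
    have : ∑ i, x i ≤ 0 := Finset.sum_nonpos fun i _ => hcon i
    linarith [hx.2]
  have hy := applyPos x hx.1 hxpos
  have heq : ∀ i, ∑ j, A i j * x j = r * x i := by
    by_contra! hcon
    obtain ⟨i₀, hi₀⟩ := hcon
    set y : α → ℝ := fun i => ∑ j, A i j * x j with hydef
    have hz : ∀ i, 0 < ∑ j, A i j * (y j - r * x j) :=
      applyPos (fun j => y j - r * x j) (fun j => sub_nonneg.2 (hle j))
        ⟨i₀, sub_pos.2 (lt_of_le_of_ne (hle i₀) (Ne.symm hi₀))⟩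
    have hz' : ∀ i, ∑ j, A i j * (y j - r * x j) = ∑ j, A i j * y j - r * y i := by
      intro i
      simp only [mul_sub, Finset.sum_sub_distrib, hydef, Finset.mul_sum]
      congr 1
      exact Finset.sum_congr rfl fun j _ => by ring
    obtain ⟨i₁, -, hi₁⟩ := Finset.exists_min_image Finset.univ
      (fun i => (∑ j, A i j * y j - r * y i) / y i) ⟨k, Finset.mem_univ k⟩
    set δ := (∑ j, A i₁ j * y j - r * y i₁) / y i₁ with hδ
    have hδpos : 0 < δ := div_pos (hz' i₁ ▸ hz i₁) (hy i₁)
    have hsum : 0 < ∑ i, y i := Finset.sum_pos (fun i _ => hy i) ⟨k, Finset.mem_univ k⟩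
    have hmem : (r + δ, fun i => y i / ∑ i, y i) ∈ S := by
      refine memS _ _ (by linarith [hr.1]) ⟨fun i => (div_pos (hy i) hsum).le, ?_⟩ fun i => ?_
      · rw [← Finset.sum_div, div_self hsum.ne']
      · have h1 := hi₁ i (Finset.mem_univ i)
        rw [le_div_iff₀ (hy i)] at h1
        have h2 : ∑ j, A i j * (y j / ∑ i, y i) = (∑ j, A i j * y j) / ∑ i, y i := by
          rw [Finset.sum_div]
          exact Finset.sum_congr rfl fun j _ => by ring
        rw [h2, ← mul_div_assoc]
        gcongr
        linarith
    have := hmax hmem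
    simp only [Set.mem_ofPred_eq] at this
    linarith
  have hrpos : 0 < r := by
    rcases hr.1.lt_or_eq with h | h
    · exact h
    · have := hy k
      rw [heq k, ← h, zero_mul] at this
      exact absurd this (lt_irrefl 0)
  refine ⟨r, x, hrpos, fun i => ?_, heq⟩
  have := hy i
  rw [heq i] at this
  exact pos_of_mul_pos_right this hrpos.le

theorem weightedOp_nonneg {K : α → α → ℝ} {w f : α → ℝ} (hK : ∀ c c', 0 ≤ K c c')
    (hw : ∀ c, 0 ≤ w c) (hf : ∀ c, 0 ≤ f c) (c : α) : 0 ≤ weightedOp K w f c :=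
  Finset.sum_nonneg fun c' _ => mul_nonneg (mul_nonneg (hK c c') (hw c')) (hf c')

theorem weightedOp_mono {K : α → α → ℝ} {w f g : α → ℝ} (hK : ∀ c c', 0 ≤ K c c')
    (hw : ∀ c, 0 ≤ w c) (hfg : ∀ c, f c ≤ g c) (c : α) : weightedOp K w f c ≤ weightedOp K w g c :=
  Finset.sum_le_sum fun c' _ => mul_le_mul_of_nonneg_left (hfg c') (mul_nonneg (hK c c') (hw c'))

theorem weightedOp_const_mul (K : α → α → ℝ) (w f : α → ℝ) (a : ℝ) :
    weightedOp K w (fun c => a * f c) = fun c => a * weightedOp K w f c := by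
  funext c
  simp only [weightedOp, Finset.mul_sum]
  exact Finset.sum_congr rfl fun c' _ => by ring

theorem iterate_weightedOp_nonneg {K : α → α → ℝ} {w f : α → ℝ} (hK : ∀ c c', 0 ≤ K c c')
    (hw : ∀ c, 0 ≤ w c) (hf : ∀ c, 0 ≤ f c) (m : ℕ) (c : α) : 0 ≤ (weightedOp K w)^[m] f c := by
  induction m generalizing c with
  | zero => exact hf c
  | succ m ih => rw [Function.iterate_succ_apply']; exact weightedOp_nonneg hK hw ih c

theorem sum_mul_weightedOp_comm {K : α → α → ℝ} (hK : ∀ c c', K c c' = K c' c) (w f g : α → ℝ) :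
    ∑ c, w c * f c * weightedOp K w g c = ∑ c, w c * weightedOp K w f c * g c := by
  simp only [weightedOp, Finset.mul_sum, Finset.sum_mul]
  rw [Finset.sum_comm]
  refine Finset.sum_congr rfl fun c _ => Finset.sum_congr rfl fun c' _ => ?_
  rw [hK c' c]
  ring

theorem sum_mul_iterate_weightedOp_comm {K : α → α → ℝ} (hK : ∀ c c', K c c' = K c' c)
    (w f g : α → ℝ) (m : ℕ) :
    ∑ c, w c * f c * (weightedOp K w)^[m] g c = ∑ c, w c * (weightedOp K w)^[m] f c * g c := by
  induction m generalizing f with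
  | zero => rfl
  | succ m ih =>
    rw [Function.iterate_succ_apply', sum_mul_weightedOp_comm hK, ih, ← Function.iterate_succ_apply]

/-- Schur test for a symmetric kernel with a positive eigenvector on the support of the weight. -/
theorem sum_weightedOp_sq_le {K : α → α → ℝ} (hKs : ∀ c c', K c c' = K c' c)
    (hK : ∀ c c', 0 ≤ K c c') {w ψ : α → ℝ} (hw : ∀ c, 0 ≤ w c) (hψ : ∀ c, 0 < ψ c) {l : ℝ}
    (hev : ∀ c, w c ≠ 0 → weightedOp K w ψ c = l * ψ c) (f : α → ℝ) :
    ∑ c, w c * weightedOp K w f c ^ 2 ≤ l ^ 2 * ∑ c, w c * f c ^ 2 := by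
  have hcs : ∀ c, w c * weightedOp K w f c ^ 2 ≤
      l * (w c * ψ c * weightedOp K w (fun c' => f c' ^ 2 / ψ c') c) := by
    intro c
    by_cases hc : w c = 0
    · simp [hc]
    have h1 : weightedOp K w f c ^ 2 ≤
        weightedOp K w ψ c * weightedOp K w (fun c' => f c' ^ 2 / ψ c') c := by
      refine Finset.sum_sq_le_sum_mul_sum_of_sq_le_mul _ (fun c' _ => ?_) (fun c' _ => ?_)
        (fun c' _ => ?_)
      · exact mul_nonneg (mul_nonneg (hK c c') (hw c')) (hψ c').le
      · exact mul_nonneg (mul_nonneg (hK c c') (hw c')) (div_nonneg (sq_nonneg _) (hψ c').le)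
      · have := (hψ c').ne'
        exact le_of_eq (by field_simp)
    rw [hev c hc] at h1
    nlinarith [hw c]
  calc ∑ c, w c * weightedOp K w f c ^ 2
      ≤ ∑ c, l * (w c * ψ c * weightedOp K w (fun c' => f c' ^ 2 / ψ c') c) :=
        Finset.sum_le_sum fun c _ => hcs c
    _ = l * ∑ c, w c * weightedOp K w ψ c * (f c ^ 2 / ψ c) := by
        rw [← Finset.mul_sum, sum_mul_weightedOp_comm hKs]
    _ = l ^ 2 * ∑ c, w c * f c ^ 2 := by
        rw [Finset.mul_sum, Finset.mul_sum]
        refine Finset.sum_congr rfl fun c _ => ?_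
        by_cases hc : w c = 0
        · simp [hc]
        rw [hev c hc]
        have := (hψ c).ne'
        field_simp

theorem sum_iterate_weightedOp_sq_le {K : α → α → ℝ} (hKs : ∀ c c', K c c' = K c' c)
    (hK : ∀ c c', 0 ≤ K c c') {w ψ : α → ℝ} (hw : ∀ c, 0 ≤ w c) (hψ : ∀ c, 0 < ψ c) {l : ℝ}
    (hev : ∀ c, w c ≠ 0 → weightedOp K w ψ c = l * ψ c) (f : α → ℝ) (m : ℕ) :
    ∑ c, w c * (weightedOp K w)^[m] f c ^ 2 ≤ (l ^ 2) ^ m * ∑ c, w c * f c ^ 2 := by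
  induction m with
  | zero => simp
  | succ m ih =>
    rw [Function.iterate_succ_apply', pow_succ']
    refine (sum_weightedOp_sq_le hKs hK hw hψ hev _).trans ?_
    rw [mul_assoc]
    exact mul_le_mul_of_nonneg_left ih (sq_nonneg l)

theorem le_iterate_weightedOp {K : α → α → ℝ} (hK : ∀ c c', 0 ≤ K c c') {w g f : α → ℝ}
    (hw : ∀ c, 0 ≤ w c) {l : ℝ} (hl : 0 ≤ l) (hg : ∀ c, l * g c ≤ weightedOp K w g c)
    (hgf : ∀ c, g c ≤ f c) (m : ℕ) (c : α) : l ^ m * g c ≤ (weightedOp K w)^[m] f c := by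
  induction m generalizing c with
  | zero => simpa using hgf c
  | succ m ih =>
    rw [Function.iterate_succ_apply']
    refine le_trans ?_ (weightedOp_mono hK hw ih c)
    rw [weightedOp_const_mul, pow_succ, mul_assoc]
    exact mul_le_mul_of_nonneg_left (hg c) (pow_nonneg hl m)

theorem iterate_weightedOp_le {K : α → α → ℝ} (hK : ∀ c c', 0 ≤ K c c') {w g f : α → ℝ}
    (hw : ∀ c, 0 ≤ w c) {l : ℝ} (hl : 0 ≤ l) (hg : ∀ c, weightedOp K w g c ≤ l * g c)
    (hgf : ∀ c, f c ≤ g c) (m : ℕ) (c : α) : (weightedOp K w)^[m] f c ≤ l ^ m * g c := by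
  induction m generalizing c with
  | zero => simpa using hgf c
  | succ m ih =>
    rw [Function.iterate_succ_apply']
    refine le_trans (weightedOp_mono hK hw ih c) ?_
    rw [weightedOp_const_mul, pow_succ, mul_assoc]
    exact mul_le_mul_of_nonneg_left (hg c) (pow_nonneg hl m)

end PositiveKernels

section FourFunctions

variable {α : Type*} [DistribLattice α]

/-- The hypothesis of the four functions theorem. -/
def FourFun (f₁ f₂ f₃ f₄ : α → ℝ) : Prop :=
  ∀ a b, f₁ a * f₂ b ≤ f₃ (a ⊓ b) * f₄ (a ⊔ b)

theorem FourFun.mul {f₁ f₂ f₃ f₄ g₁ g₂ g₃ g₄ : α → ℝ} (hf : FourFun f₁ f₂ f₃ f₄)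
    (hg : FourFun g₁ g₂ g₃ g₄) (f₁0 : ∀ a, 0 ≤ f₁ a) (f₂0 : ∀ a, 0 ≤ f₂ a)
    (g₁0 : ∀ a, 0 ≤ g₁ a) (g₂0 : ∀ a, 0 ≤ g₂ a) :
    FourFun (fun a => f₁ a * g₁ a) (fun a => f₂ a * g₂ a) (fun a => f₃ a * g₃ a)
      (fun a => f₄ a * g₄ a) := by
  intro a b
  calc f₁ a * g₁ a * (f₂ b * g₂ b) = (f₁ a * f₂ b) * (g₁ a * g₂ b) := by ring
    _ ≤ (f₃ (a ⊓ b) * f₄ (a ⊔ b)) * (g₃ (a ⊓ b) * g₄ (a ⊔ b)) :=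
        mul_le_mul (hf a b) (hg a b) (mul_nonneg (g₁0 a) (g₂0 b))
          ((mul_nonneg (f₁0 a) (f₂0 b)).trans (hf a b))
    _ = _ := by ring

/-- Log-supermodularity of a kernel on a lattice. -/
def SupermodularKernel (K : α → α → ℝ) : Prop :=
  ∀ a b a' b', K a a' * K b b' ≤ K (a ⊓ b) (a' ⊓ b') * K (a ⊔ b) (a' ⊔ b')

variable [Fintype α]

theorem FourFun.weightedOp {K : α → α → ℝ} (hKm : SupermodularKernel K) (hK : ∀ a b, 0 ≤ K a b)
    {w₁ w₂ w₃ w₄ f₁ f₂ f₃ f₄ : α → ℝ} (hw : FourFun w₁ w₂ w₃ w₄) (hf : FourFun f₁ f₂ f₃ f₄)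
    (w₁0 : ∀ a, 0 ≤ w₁ a) (w₂0 : ∀ a, 0 ≤ w₂ a) (w₃0 : ∀ a, 0 ≤ w₃ a) (w₄0 : ∀ a, 0 ≤ w₄ a)
    (f₁0 : ∀ a, 0 ≤ f₁ a) (f₂0 : ∀ a, 0 ≤ f₂ a) (f₃0 : ∀ a, 0 ≤ f₃ a) (f₄0 : ∀ a, 0 ≤ f₄ a) :
    FourFun (_root_.weightedOp K w₁ f₁) (_root_.weightedOp K w₂ f₂) (_root_.weightedOp K w₃ f₃)
      (_root_.weightedOp K w₄ f₄) := by
  intro a b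
  refine four_functions_theorem_univ (fun c => K a c * w₁ c * f₁ c) (fun c => K b c * w₂ c * f₂ c)
    (fun c => K (a ⊓ b) c * w₃ c * f₃ c) (fun c => K (a ⊔ b) c * w₄ c * f₄ c)
    (fun c => mul_nonneg (mul_nonneg (hK _ _) (w₁0 c)) (f₁0 c))
    (fun c => mul_nonneg (mul_nonneg (hK _ _) (w₂0 c)) (f₂0 c))
    (fun c => mul_nonneg (mul_nonneg (hK _ _) (w₃0 c)) (f₃0 c))
    (fun c => mul_nonneg (mul_nonneg (hK _ _) (w₄0 c)) (f₄0 c)) fun c d => ?_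
  have h := hw.mul hf w₁0 w₂0 f₁0 f₂0 c d
  have hk := hKm a b c d
  calc K a c * w₁ c * f₁ c * (K b d * w₂ d * f₂ d)
      = (K a c * K b d) * (w₁ c * f₁ c * (w₂ d * f₂ d)) := by ring
    _ ≤ (K (a ⊓ b) (c ⊓ d) * K (a ⊔ b) (c ⊔ d)) *
        (w₃ (c ⊓ d) * f₃ (c ⊓ d) * (w₄ (c ⊔ d) * f₄ (c ⊔ d))) :=
        mul_le_mul hk h (mul_nonneg (mul_nonneg (w₁0 c) (f₁0 c)) (mul_nonneg (w₂0 d) (f₂0 d)))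
          (mul_nonneg (hK _ _) (hK _ _))
    _ = _ := by ring

theorem FourFun.iterate_weightedOp {K : α → α → ℝ} (hKm : SupermodularKernel K)
    (hK : ∀ a b, 0 ≤ K a b) {w₁ w₂ w₃ w₄ f₁ f₂ f₃ f₄ : α → ℝ} (hw : FourFun w₁ w₂ w₃ w₄)
    (hf : FourFun f₁ f₂ f₃ f₄)
    (w₁0 : ∀ a, 0 ≤ w₁ a) (w₂0 : ∀ a, 0 ≤ w₂ a) (w₃0 : ∀ a, 0 ≤ w₃ a) (w₄0 : ∀ a, 0 ≤ w₄ a)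
    (f₁0 : ∀ a, 0 ≤ f₁ a) (f₂0 : ∀ a, 0 ≤ f₂ a) (f₃0 : ∀ a, 0 ≤ f₃ a) (f₄0 : ∀ a, 0 ≤ f₄ a)
    (m : ℕ) :
    FourFun ((_root_.weightedOp K w₁)^[m] f₁) ((_root_.weightedOp K w₂)^[m] f₂)
      ((_root_.weightedOp K w₃)^[m] f₃) ((_root_.weightedOp K w₄)^[m] f₄) := by
  induction m with
  | zero => exact hf
  | succ m ih =>
    simp only [Function.iterate_succ_apply']
    exact FourFun.weightedOp hKm hK hw ih w₁0 w₂0 w₃0 w₄0 (iterate_weightedOp_nonneg hK w₁0 f₁0 m)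
      (iterate_weightedOp_nonneg hK w₂0 f₂0 m) (iterate_weightedOp_nonneg hK w₃0 f₃0 m)
      (iterate_weightedOp_nonneg hK w₄0 f₄0 m)

end FourFunctions

section HalfColumn

/-- The sequence `s, u 0, …, u (N - 1), t, t, …`. -/
def bordered {α : Type*} {N : ℕ} (s t : α) (u : Fin N → α) : ℕ → α
  | 0 => s
  | i + 1 => if h : i < N then u ⟨i, h⟩ else t

/-- Interaction energy inside a column with spins `u`, bottom spin `s` and top spin `t`. -/
def chainEnergy {N : ℕ} (s t : Bool) (u : Fin N → Bool) : ℝ :=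
  ∑ i ∈ Finset.range (N + 1), sval (bordered s t u i) * sval (bordered s t u (i + 1))

/-- Interaction energy between two columns. -/
def overlap {ι : Type*} [Fintype ι] (u v : ι → Bool) : ℝ := ∑ i, sval (u i) * sval (v i)

theorem sval_not (b : Bool) : sval (!b) = -sval b := by cases b <;> simp [sval]

theorem sval_eq (b : Bool) : sval b = 1 ∨ sval b = -1 := by cases b <;> simp [sval]

theorem overlap_comm {ι : Type*} [Fintype ι] (u v : ι → Bool) : overlap u v = overlap v u :=
  Finset.sum_congr rfl fun _ _ => mul_comm _ _

theorem overlap_not_not {ι : Type*} [Fintype ι] (u v : ι → Bool) :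
    overlap (fun i => !u i) (fun i => !v i) = overlap u v :=
  Finset.sum_congr rfl fun _ _ => by rw [sval_not, sval_not, neg_mul_neg]

theorem bordered_not {N : ℕ} (s t : Bool) (u : Fin N → Bool) (i : ℕ) :
    bordered (!s) (!t) (fun k => !u k) i = !bordered s t u i := by
  cases i with
  | zero => rfl
  | succ i => by_cases h : i < N <;> simp [bordered, h]

theorem chainEnergy_not {N : ℕ} (s t : Bool) (u : Fin N → Bool) :
    chainEnergy (!s) (!t) (fun k => !u k) = chainEnergy s t u :=
  Finset.sum_congr rfl fun _ _ => by rw [bordered_not, bordered_not, sval_not, sval_not, neg_mul_neg]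

variable {N : ℕ}

/-- Flip the spins with index less than `b`. -/
def flipBelow (b : ℕ) (u : Fin N → Bool) : Fin N → Bool :=
  fun i => if i.1 < b then !u i else u i

/-- Flip the spin with index `j`. -/
def flipAt (j : Fin N) (u : Fin N → Bool) : Fin N → Bool :=
  Function.update u j (!u j)

theorem flipBelow_involutive (b : ℕ) : Function.Involutive (flipBelow (N := N) b) := by
  intro u
  funext i
  by_cases h : i.1 < b <;> simp [flipBelow, h]

theorem flipAt_involutive (j : Fin N) : Function.Involutive (flipAt j) := by
  intro u
  simp [flipAt]

theorem flipBelow_succ_flipAt (j : Fin N) (u : Fin N → Bool) :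
    flipBelow (j + 1) (flipAt j u) = flipBelow j u := by
  funext i
  rcases lt_trichotomy i j with h | h | h
  · have h1 : i.1 < j.1 + 1 := Nat.lt_succ_of_lt h
    have h2 : i.1 < j.1 := h
    simp [flipBelow, flipAt, h1, h2, h.ne]
  · subst h
    simp [flipBelow, flipAt]
  · have h1 : ¬ i.1 < j.1 + 1 := by have : j.1 < i.1 := h; omega
    have h2 : ¬ i.1 < j.1 := by omega
    simp [flipBelow, flipAt, h1, h2, h.ne']

theorem overlap_flipBelow (b : ℕ) (u v : Fin N → Bool) :
    overlap (flipBelow b u) (flipBelow b v) = overlap u v := by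
  refine Finset.sum_congr rfl fun i _ => ?_
  by_cases h : i.1 < b <;> simp [flipBelow, h, sval_not]

theorem overlap_flipAt (j : Fin N) (u v : Fin N → Bool) :
    overlap (flipAt j u) v = overlap u v - 2 * (sval (u j) * sval (v j)) := by
  unfold overlap
  rw [← Finset.add_sum_erase _ _ (Finset.mem_univ j),
    ← Finset.add_sum_erase _ (fun i => sval (u i) * sval (v i)) (Finset.mem_univ j)]
  have : ∀ i ∈ Finset.univ.erase j, sval (flipAt j u i) * sval (v i) = sval (u i) * sval (v i) := by
    intro i hi
    rw [flipAt, Function.update_of_ne (Finset.ne_of_mem_erase hi)]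
  rw [Finset.sum_congr rfl this, flipAt, Function.update_self, sval_not]
  ring

theorem bordered_flipBelow {b : ℕ} (hb : b ≤ N) (s t : Bool) (u : Fin N → Bool) (i : ℕ) :
    bordered (!s) t (flipBelow b u) i =
      if i ≤ b then !bordered s t u i else bordered s t u i := by
  cases i with
  | zero => simp [bordered]
  | succ i =>
    by_cases h : i < N
    · simp [bordered, h, flipBelow]
    · have : ¬ i + 1 ≤ b := by omega
      simp [bordered, h, this]

theorem chainEnergy_flipBelow {b : ℕ} (hb : b ≤ N) (s t : Bool) (u : Fin N → Bool) :
    chainEnergy (!s) t (flipBelow b u) =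
      chainEnergy s t u - 2 * (sval (bordered s t u b) * sval (bordered s t u (b + 1))) := by
  unfold chainEnergy
  have hmem : b ∈ Finset.range (N + 1) := Finset.mem_range.2 (by omega)
  rw [← Finset.add_sum_erase _ _ hmem, ← Finset.add_sum_erase _ (fun i =>
    sval (bordered s t u i) * sval (bordered s t u (i + 1))) hmem]
  have : ∀ i ∈ (Finset.range (N + 1)).erase b,
      sval (bordered (!s) t (flipBelow b u) i) * sval (bordered (!s) t (flipBelow b u) (i + 1)) =
        sval (bordered s t u i) * sval (bordered s t u (i + 1)) := by
    intro i hi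
    have hne := Finset.ne_of_mem_erase hi
    rw [bordered_flipBelow hb, bordered_flipBelow hb]
    rcases lt_or_gt_of_ne hne with h | h
    · rw [if_pos h.le, if_pos (Nat.succ_le_of_lt h), sval_not, sval_not, neg_mul_neg]
    · rw [if_neg (by omega), if_neg (by omega)]
  rw [Finset.sum_congr rfl this, bordered_flipBelow hb, bordered_flipBelow hb, if_pos le_rfl,
    if_neg (by omega), sval_not]
  ring

theorem sum_flipAt (j : Fin N) (f : (Fin N → Bool) → ℝ) : ∑ u, f (flipAt j u) = ∑ u, f u :=
  (flipAt_involutive j).bijective.sum_comp f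

theorem sum_flipBelow (b : ℕ) (f : (Fin N → Bool) → ℝ) : ∑ u, f (flipBelow b u) = ∑ u, f u :=
  (flipBelow_involutive b).bijective.sum_comp f

/-- Transfer kernel between consecutive half columns. -/
noncomputable def halfKernel (β : ℝ) (u v : Fin N → Bool) : ℝ := Real.exp (β * overlap u v)

/-- Weight of a half column with bottom spin `s` and top spin `t`. -/
noncomputable def halfWeight (β : ℝ) (s t : Bool) (u : Fin N → Bool) : ℝ := Real.exp (β * chainEnergy s t u)

theorem spin_recursion_neg {w k r s d s' d' : ℝ} (hw : 3 < w) (hwk : w * k = 1) (hr : 1 ≤ r)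
    (hr' : r < 3 / 2) (hs : s < 0) (hd : d < 0)
    (h₁ : r * (s' + d') = (w + k) / 2 * (r * (s - d)) - (w - k) / 2 * (k * s - w * d))
    (h₂ : k * s' + w * d' = -((w + k) / 2) * (k * s - w * d) + (w - k) / 2 * (r * (s - d))) :
    s' < 0 ∧ d' < 0 := by
  have hk : 0 < k := pos_of_mul_pos_right (hwk ▸ one_pos) (by linarith)
  have hk3 : k < 1 / 3 := by nlinarith
  set a := (w - k) / 2 with ha
  have ha' : 4 / 3 < a := by rw [ha]; linarith
  have hC : ((w + k) / 2) ^ 2 = 1 + a ^ 2 := by rw [ha]; linear_combination hwk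
  set C := (w + k) / 2 with hCdef
  have hwC : w = C + a := by rw [ha, hCdef]; ring
  have hkC : k = C - a := by rw [ha, hCdef]; ring
  have c1 : 0 < 2 * C ^ 2 * r - a * (r ^ 2 + 1) := by
    have : r ^ 2 + 1 ≤ 13 / 6 * r := by nlinarith
    rw [hC]
    nlinarith [sq_nonneg (a - 13 / 24), mul_pos (show (0:ℝ) < a by linarith) (show (0:ℝ) < r by linarith)]
  have c2 : 0 < a * (r ^ 2 + w ^ 2) - 2 * C * w * r := by
    have e : 2 * w * (a * (r ^ 2 + w ^ 2) - 2 * C * w * r) =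
        (w - 3) * (w ^ 3 + 5 / 4 * w + 3 / 4) +
          (3 / 2 - r) * (2 * w * (w ^ 2 + 1) - (w ^ 2 - 1) * (r + 3 / 2)) := by
      rw [ha, hCdef]
      linear_combination (-(r ^ 2 + w ^ 2) - 2 * w * r) * hwk
    have e2 : 0 < (w - 3) * (w ^ 3 + 5 / 4 * w + 3 / 4) := by
      have : 0 < w - 3 := by linarith
      positivity
    have e3 : 0 < 2 * w * (w ^ 2 + 1) - (w ^ 2 - 1) * (r + 3 / 2) := by nlinarith
    have e4 : 0 < (3 / 2 - r) * (2 * w * (w ^ 2 + 1) - (w ^ 2 - 1) * (r + 3 / 2)) :=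
      mul_pos (by linarith) e3
    exact pos_of_mul_pos_right (e ▸ add_pos e2 e4) (by linarith)
  have c3 : 0 < a * (r ^ 2 + k ^ 2) - 2 * C * k * r := by
    have : 0 < a * r - 2 * C * k := by
      have : 2 * C * k = 1 + k ^ 2 := by rw [hCdef]; linear_combination hwk
      nlinarith
    nlinarith [mul_pos this (show (0:ℝ) < r by linarith), mul_pos (show (0:ℝ) < a by linarith) (pow_pos hk 2)]
  clear_value a C
  subst hwC hkC
  have e1 : 2 * a * r * s' = s * (2 * C ^ 2 * r - a * (r ^ 2 + 1)) +
      d * (a * (r ^ 2 + (C + a) ^ 2) - 2 * C * (C + a) * r) := by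
    linear_combination (C + a) * h₁ - r * h₂ - s * a * hwk
  have e2 : 2 * a * r * d' = s * (a * (r ^ 2 + (C - a) ^ 2) - 2 * C * (C - a) * r) +
      d * (2 * C ^ 2 * r - a * (r ^ 2 + 1)) := by
    linear_combination r * h₂ - (C - a) * h₁ - d * a * hwk
  have har : 0 < 2 * a * r := by nlinarith
  constructor
  · by_contra! h
    nlinarith [mul_pos_of_neg_of_neg hs (neg_neg_of_pos c1), mul_pos_of_neg_of_neg hd (neg_neg_of_pos c2), mul_nonneg har.le h]
  · by_contra! h
    nlinarith [mul_pos_of_neg_of_neg hs (neg_neg_of_pos c3), mul_pos_of_neg_of_neg hd (neg_neg_of_pos c1), mul_nonneg har.le h]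

end HalfColumn

section SpectralGap

variable {N : ℕ}

theorem exp_neg_two_mul_sval {w k β : ℝ} (hw : w = Real.exp (2 * β)) (hk : k = Real.exp (-(2 * β)))
    (a b : Bool) : Real.exp (-(2 * β) * (sval a * sval b)) =
      (w + k) / 2 - (w - k) / 2 * (sval a * sval b) := by
  subst hw hk
  rcases sval_eq a with ha | ha <;> rcases sval_eq b with hb | hb <;> rw [ha, hb] <;> norm_num <;>
    ring

/-- Disorder correlation with a marked spin, seen from the site after a transfer. -/
def disorderRight (D φ ψ : (Fin N → Bool) → ℝ) (b i : ℕ) : ℝ :=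
  ∑ u, sval (bordered false true u i) * (φ (flipBelow b u) * (D u * ψ u))

/-- Disorder correlation with a marked spin, seen from the site before a transfer. -/
def disorderLeft (D φ ψ : (Fin N → Bool) → ℝ) (b i : ℕ) : ℝ :=
  ∑ u, sval (bordered false true u i) * (D (flipBelow b u) * φ (flipBelow b u) * ψ u)

/-- The two-column summand relating `disorderLeft` and `disorderRight`. -/
noncomputable def disorderPair (β : ℝ) (D E φ ψ : (Fin N → Bool) → ℝ) (b : ℕ) (u v : Fin N → Bool) : ℝ :=
  D (flipBelow b u) * φ (flipBelow b u) * (halfKernel β u v * (E v * ψ v))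

theorem disorderLeft_eq_sum_pair {β l : ℝ} {D E φ ψ : (Fin N → Bool) → ℝ}
    (hψ : ∀ u, ∑ v, halfKernel β u v * (E v * ψ v) = l * ψ u) (b i : ℕ) :
    l * disorderLeft D φ ψ b i =
      ∑ u, ∑ v, sval (bordered false true u i) * disorderPair β D E φ ψ b u v := by
  rw [disorderLeft, Finset.mul_sum]
  refine Finset.sum_congr rfl fun u _ => ?_
  simp only [disorderPair, ← Finset.mul_sum, hψ]
  ring

theorem disorderRight_eq_sum_pair {β l : ℝ} {D E φ ψ : (Fin N → Bool) → ℝ}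
    (hφ : ∀ u, ∑ v, halfKernel β u v * (D v * φ v) = l * φ u) (b i : ℕ) :
    l * disorderRight E φ ψ b i =
      ∑ u, ∑ v, sval (bordered false true v i) * disorderPair β D E φ ψ b u v := by
  rw [disorderRight, Finset.mul_sum, Finset.sum_comm]
  refine Finset.sum_congr rfl fun v _ => ?_
  have h := hφ (flipBelow b v)
  rw [← sum_flipBelow b] at h
  have h' : ∑ u, halfKernel β u v * (D (flipBelow b u) * φ (flipBelow b u)) =
      l * φ (flipBelow b v) := by
    rw [← h]
    refine Finset.sum_congr rfl fun u _ => ?_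
    rw [halfKernel, halfKernel, overlap_flipBelow, overlap_comm]
  rw [show l * (sval (bordered false true v i) * (φ (flipBelow b v) * (E v * ψ v))) =
    (l * φ (flipBelow b v)) * (sval (bordered false true v i) * (E v * ψ v)) by ring, ← h',
    Finset.sum_mul]
  refine Finset.sum_congr rfl fun u _ => ?_
  rw [disorderPair]
  ring

theorem disorderPair_flipAt {w k β : ℝ} (hw : w = Real.exp (2 * β))
    (hk : k = Real.exp (-(2 * β))) (D E φ ψ : (Fin N → Bool) → ℝ) (j : Fin N)
    (u v : Fin N → Bool) :
    disorderPair β D E φ ψ (j + 1) (flipAt j u) v =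
      ((w + k) / 2 - (w - k) / 2 * (sval (u j) * sval (v j))) * disorderPair β D E φ ψ j u v := by
  rw [disorderPair, disorderPair, flipBelow_succ_flipAt, halfKernel, overlap_flipAt, mul_sub,
    show β * overlap u v - β * (2 * (sval (u j) * sval (v j))) =
      -(2 * β) * (sval (u j) * sval (v j)) + β * overlap u v by ring, Real.exp_add,
    exp_neg_two_mul_sval hw hk, halfKernel]
  ring

theorem bordered_succ {α : Type*} (s t : α) (u : Fin N → α) (j : Fin N) :
    bordered s t u (j + 1) = u j := by
  simp [bordered]

theorem sval_mul_self (b : Bool) : sval b * sval b = 1 := by cases b <;> simp [sval]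

theorem disorder_step {w k β lo le : ℝ} (hw : w = Real.exp (2 * β))
    (hk : k = Real.exp (-(2 * β))) {D E φ ψ : (Fin N → Bool) → ℝ}
    (hφ : ∀ u, ∑ v, halfKernel β u v * (D v * φ v) = le * φ u)
    (hψ : ∀ u, ∑ v, halfKernel β u v * (E v * ψ v) = lo * ψ u) (j : Fin N) :
    lo * disorderLeft D φ ψ (j + 1) (j + 1) =
        -((w + k) / 2) * (lo * disorderLeft D φ ψ j (j + 1)) +
          (w - k) / 2 * (le * disorderRight E φ ψ j (j + 1)) ∧
      le * disorderRight E φ ψ (j + 1) (j + 1) =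
        (w + k) / 2 * (le * disorderRight E φ ψ j (j + 1)) -
          (w - k) / 2 * (lo * disorderLeft D φ ψ j (j + 1)) := by
  rw [disorderLeft_eq_sum_pair hψ, disorderLeft_eq_sum_pair hψ, disorderRight_eq_sum_pair hφ,
    disorderRight_eq_sum_pair hφ]
  rw [← sum_flipAt j (fun u => ∑ v, sval (bordered false true u (j + 1)) *
      disorderPair β D E φ ψ (j + 1) u v),
    ← sum_flipAt j (fun u => ∑ v, sval (bordered false true v (j + 1)) *
      disorderPair β D E φ ψ (j + 1) u v)]
  simp only [disorderPair_flipAt hw hk, bordered_succ, Finset.mul_sum, ← Finset.sum_add_distrib,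
    ← Finset.sum_sub_distrib]
  constructor
  · refine Finset.sum_congr rfl fun u _ => Finset.sum_congr rfl fun v _ => ?_
    rw [flipAt, Function.update_self, sval_not]
    linear_combination (w - k) / 2 * sval (v j) * disorderPair β D E φ ψ j u v * sval_mul_self (u j)
  · refine Finset.sum_congr rfl fun u _ => Finset.sum_congr rfl fun v _ => ?_
    linear_combination -(w - k) / 2 * sval (u j) * disorderPair β D E φ ψ j u v * sval_mul_self (v j)

theorem disorderLeft_eq {w k β : ℝ} (hw : w = Real.exp (2 * β))
    (hk : k = Real.exp (-(2 * β))) (φ ψ : (Fin N → Bool) → ℝ) {b : ℕ} (hb : b ≤ N) (i : ℕ) :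
    disorderLeft (halfWeight β true true) φ ψ b i =
      ∑ u, sval (bordered false true u i) *
        ((w + k) / 2 - (w - k) / 2 *
          (sval (bordered false true u b) * sval (bordered false true u (b + 1)))) *
        (φ (flipBelow b u) * (halfWeight β false true u * ψ u)) := by
  refine Finset.sum_congr rfl fun u _ => ?_
  have h := chainEnergy_flipBelow hb false true u
  rw [Bool.not_false] at h
  rw [halfWeight, h, mul_sub, show ∀ x y, β * x - β * (2 * y) = -(2 * β) * y + β * x by
    intro x y; ring, Real.exp_add, exp_neg_two_mul_sval hw hk, halfWeight]
  ring

theorem disorderLeft_add {w k β : ℝ} (hw : w = Real.exp (2 * β))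
    (hk : k = Real.exp (-(2 * β))) (φ ψ : (Fin N → Bool) → ℝ) {b : ℕ} (hb : b ≤ N) :
    disorderLeft (halfWeight β true true) φ ψ b b =
        (w + k) / 2 * disorderRight (halfWeight β false true) φ ψ b b -
          (w - k) / 2 * disorderRight (halfWeight β false true) φ ψ b (b + 1) ∧
      disorderLeft (halfWeight β true true) φ ψ b (b + 1) =
        (w + k) / 2 * disorderRight (halfWeight β false true) φ ψ b (b + 1) -
          (w - k) / 2 * disorderRight (halfWeight β false true) φ ψ b b := by
  rw [disorderLeft_eq hw hk φ ψ hb, disorderLeft_eq hw hk φ ψ hb]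
  simp only [disorderRight, Finset.mul_sum, ← Finset.sum_sub_distrib]
  constructor
  · refine Finset.sum_congr rfl fun u _ => ?_
    linear_combination -(w - k) / 2 * sval (bordered false true u (b + 1)) *
      (φ (flipBelow b u) * (halfWeight β false true u * ψ u)) *
      sval_mul_self (bordered false true u b)
  · refine Finset.sum_congr rfl fun u _ => ?_
    linear_combination -(w - k) / 2 * sval (bordered false true u b) *
      (φ (flipBelow b u) * (halfWeight β false true u * ψ u)) *
      sval_mul_self (bordered false true u (b + 1))

/-- Above the temperature threshold `exp (2β) > 3`, the half-column transfer operator with a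
Dobrushin interface is smaller by a factor `2/3` than the one with pure boundary conditions. -/
theorem interface_eigenvalue_gap {β lo le : ℝ} (hβ : 3 < Real.exp (2 * β))
    {φ ψ : (Fin N → Bool) → ℝ} (hφ0 : ∀ u, 0 < φ u) (hψ0 : ∀ u, 0 < ψ u) (hlo : 0 < lo)
    (hle : lo ≤ le)
    (hφ : ∀ u, ∑ v, halfKernel β u v * (halfWeight β true true v * φ v) = le * φ u)
    (hψ : ∀ u, ∑ v, halfKernel β u v * (halfWeight β false true v * ψ v) = lo * ψ u) :
    3 * lo ≤ 2 * le := by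
  by_contra! hcon
  obtain ⟨w, hw⟩ : ∃ w, w = Real.exp (2 * β) := ⟨_, rfl⟩
  obtain ⟨k, hk⟩ : ∃ k, k = Real.exp (-(2 * β)) := ⟨_, rfl⟩
  have hw3 : 3 < w := hw ▸ hβ
  have hwk : w * k = 1 := by rw [hw, hk, ← Real.exp_add, add_neg_cancel, Real.exp_zero]
  have hk1 : k < 1 := by nlinarith
  set r := le / lo with hr
  have hr1 : 1 ≤ r := (one_le_div hlo).2 hle
  have hr2 : r < 3 / 2 := by rw [hr, div_lt_iff₀ hlo]; linarith
  have hler : le = lo * r := by rw [hr]; field_simp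
  let L := disorderLeft (halfWeight β true true) φ ψ
  let R := disorderRight (halfWeight β false true) φ ψ
  have hpos : ∀ b u, 0 < φ (flipBelow b u) * (halfWeight β false true u * ψ u) := fun b u =>
    mul_pos (hφ0 _) (mul_pos (Real.exp_pos _) (hψ0 u))
  have key : ∀ b, b ≤ N → R b b + R b (b + 1) < 0 ∧ R b b - R b (b + 1) < 0 := by
    intro b
    induction b with
    | zero =>
      intro _
      have hb : lo * L 0 0 = le * R 0 0 := by
        simp only [L, R]
        rw [disorderLeft_eq_sum_pair hψ, disorderRight_eq_sum_pair hφ]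
        rfl
      have hs : R 0 0 + R 0 (0 + 1) ≤ 0 := by
        simp only [R, disorderRight, ← Finset.sum_add_distrib, ← add_mul]
        refine Finset.sum_nonpos fun u _ => mul_nonpos_of_nonpos_of_nonneg ?_ (hpos 0 u).le
        rcases sval_eq (bordered false true u (0 + 1)) with h | h <;> rw [h] <;>
          simp [bordered, sval]
      have hd : R 0 0 - R 0 (0 + 1) ≤ 0 := by
        simp only [R, disorderRight, ← Finset.sum_sub_distrib, ← sub_mul]
        refine Finset.sum_nonpos fun u _ => mul_nonpos_of_nonpos_of_nonneg ?_ (hpos 0 u).le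
        rcases sval_eq (bordered false true u (0 + 1)) with h | h <;> rw [h] <;>
          simp [bordered, sval]
      have h0 : R 0 0 < 0 := by
        simp only [R, disorderRight]
        refine Finset.sum_neg (fun u _ => mul_neg_of_neg_of_pos ?_ (hpos 0 u)) Finset.univ_nonempty
        simp [bordered, sval]
      have hL := (disorderLeft_add hw hk φ ψ (Nat.zero_le N)).1
      change L 0 0 = (w + k) / 2 * R 0 0 - (w - k) / 2 * R 0 (0 + 1) at hL
      have hb' : L 0 0 = r * R 0 0 := by
        rw [hler, mul_assoc] at hb
        exact mul_left_cancel₀ hlo.ne' hb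
      have hrel : (w - r) * (R 0 0 - R 0 (0 + 1)) = (r - k) * (R 0 0 + R 0 (0 + 1)) := by
        linear_combination 2 * hb' - 2 * hL
      constructor
      · by_contra! h
        have : R 0 0 - R 0 (0 + 1) < 0 := by linarith
        nlinarith
      · by_contra! h
        have : R 0 0 + R 0 (0 + 1) < 0 := by linarith
        nlinarith
    | succ j ih =>
      intro hj
      obtain ⟨hs, hd⟩ := ih (by omega)
      obtain ⟨st1, st2⟩ := disorder_step hw hk hφ hψ ⟨j, hj⟩
      change lo * L (j + 1) (j + 1) = -((w + k) / 2) * (lo * L j (j + 1)) +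
        (w - k) / 2 * (le * R j (j + 1)) at st1
      change le * R (j + 1) (j + 1) = (w + k) / 2 * (le * R j (j + 1)) -
        (w - k) / 2 * (lo * L j (j + 1)) at st2
      obtain ⟨a1, a2⟩ := disorderLeft_add hw hk φ ψ (show j ≤ N by omega)
      obtain ⟨b1, -⟩ := disorderLeft_add hw hk φ ψ hj
      change L j j = (w + k) / 2 * R j j - (w - k) / 2 * R j (j + 1) at a1
      change L j (j + 1) = (w + k) / 2 * R j (j + 1) - (w - k) / 2 * R j j at a2
      change L (j + 1) (j + 1) = (w + k) / 2 * R (j + 1) (j + 1) -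
        (w - k) / 2 * R (j + 1) (j + 1 + 1) at b1
      have st1' : L (j + 1) (j + 1) = -((w + k) / 2) * L j (j + 1) +
          (w - k) / 2 * (r * R j (j + 1)) := by
        refine mul_left_cancel₀ hlo.ne' ?_
        rw [st1, hler]; ring
      have st2' : r * R (j + 1) (j + 1) = (w + k) / 2 * (r * R j (j + 1)) -
          (w - k) / 2 * L j (j + 1) := by
        refine mul_left_cancel₀ hlo.ne' ?_
        rw [← mul_assoc, ← hler, st2, hler]; ring
      refine spin_recursion_neg hw3 hwk hr1 hr2 hs hd ?_ ?_
      · linear_combination 2 * st2' - (w - k) * a2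
      · linear_combination 2 * st1' - (w + k) * a2 - 2 * b1
  have hN := (key N le_rfl).1
  refine hN.not_ge ?_
  simp only [R, disorderRight, ← Finset.sum_add_distrib, ← add_mul]
  refine Finset.sum_nonneg fun u _ => mul_nonneg ?_ (hpos N u).le
  rcases sval_eq (bordered false true u N) with h | h <;> rw [h] <;>
    simp [bordered, sval]

end SpectralGap

section EigenvalueComparison

theorem weightedOp_comp_equiv {α : Type*} [Fintype α] (e : α ≃ α) {K : α → α → ℝ} {w w' f f' : α → ℝ}
    (hK : ∀ a b, K (e a) (e b) = K a b) (hw : ∀ a, w' (e a) = w a) (hf : ∀ a, f' (e a) = f a)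
    (a : α) : weightedOp K w' f' (e a) = weightedOp K w f a := by
  rw [weightedOp, ← e.sum_comp, weightedOp]
  exact Finset.sum_congr rfl fun b _ => by rw [hK, hw, hf]

theorem iterate_weightedOp_comp_equiv {α : Type*} [Fintype α] (e : α ≃ α) {K : α → α → ℝ}
    {w w' f f' : α → ℝ} (hK : ∀ a b, K (e a) (e b) = K a b) (hw : ∀ a, w' (e a) = w a)
    (hf : ∀ a, f' (e a) = f a) (m : ℕ) (a : α) :
    (weightedOp K w')^[m] f' (e a) = (weightedOp K w)^[m] f a := by
  induction m generalizing a with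
  | zero => exact hf a
  | succ m ih =>
    rw [Function.iterate_succ_apply', Function.iterate_succ_apply']
    exact weightedOp_comp_equiv e hK hw ih a

theorem sval_mul_add_le (a b c d : Bool) :
    sval a * sval b + sval c * sval d ≤
      sval (a ⊓ c) * sval (b ⊓ d) + sval (a ⊔ c) * sval (b ⊔ d) := by
  cases a <;> cases b <;> cases c <;> cases d <;> simp [sval] <;> norm_num

theorem overlap_add_le {ι : Type*} [Fintype ι] (a b a' b' : ι → Bool) :
    overlap a a' + overlap b b' ≤ overlap (a ⊓ b) (a' ⊓ b') + overlap (a ⊔ b) (a' ⊔ b') := by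
  simp only [overlap, ← Finset.sum_add_distrib]
  exact Finset.sum_le_sum fun i _ => sval_mul_add_le _ _ _ _

variable {N : ℕ}

theorem bordered_inf (s t s' t' : Bool) (u v : Fin N → Bool) (i : ℕ) :
    bordered (s ⊓ s') (t ⊓ t') (u ⊓ v) i = bordered s t u i ⊓ bordered s' t' v i := by
  cases i with
  | zero => rfl
  | succ i => by_cases h : i < N <;> simp [bordered, h]

theorem bordered_sup (s t s' t' : Bool) (u v : Fin N → Bool) (i : ℕ) :
    bordered (s ⊔ s') (t ⊔ t') (u ⊔ v) i = bordered s t u i ⊔ bordered s' t' v i := by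
  cases i with
  | zero => rfl
  | succ i => by_cases h : i < N <;> simp [bordered, h]

theorem chainEnergy_add_le (s t s' t' : Bool) (u v : Fin N → Bool) :
    chainEnergy s t u + chainEnergy s' t' v ≤
      chainEnergy (s ⊓ s') (t ⊓ t') (u ⊓ v) + chainEnergy (s ⊔ s') (t ⊔ t') (u ⊔ v) := by
  simp only [chainEnergy, ← Finset.sum_add_distrib, bordered_inf, bordered_sup]
  exact Finset.sum_le_sum fun i _ => sval_mul_add_le _ _ _ _

theorem exp_mul_exp_le {β x y z t : ℝ} (hβ : 0 ≤ β) (h : x + y ≤ z + t) :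
    Real.exp (β * x) * Real.exp (β * y) ≤ Real.exp (β * z) * Real.exp (β * t) := by
  rw [← Real.exp_add, ← Real.exp_add, ← mul_add, ← mul_add]
  exact Real.exp_le_exp.2 (mul_le_mul_of_nonneg_left h hβ)

theorem supermodularKernel_halfKernel {β : ℝ} (hβ : 0 ≤ β) :
    SupermodularKernel (halfKernel (N := N) β) :=
  fun _ _ _ _ => exp_mul_exp_le hβ (overlap_add_le _ _ _ _)

theorem fourFun_halfWeight {β : ℝ} (hβ : 0 ≤ β) (s t s' t' : Bool) :
    FourFun (halfWeight (N := N) β s t) (halfWeight β s' t') (halfWeight β (s ⊓ s') (t ⊓ t'))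
      (halfWeight β (s ⊔ s') (t ⊔ t')) :=
  fun _ _ => exp_mul_exp_le hβ (chainEnergy_add_le _ _ _ _ _ _)

theorem iterate_halfOp_not (β : ℝ) (s t : Bool) (m : ℕ) (u : Fin N → Bool) :
    (weightedOp (halfKernel β) (halfWeight β (!s) (!t)))^[m] (fun _ => 1) (fun i => !u i) =
      (weightedOp (halfKernel β) (halfWeight β s t))^[m] (fun _ => 1) u := by
  refine iterate_weightedOp_comp_equiv (Equiv.piCongrRight fun _ : Fin N => Equiv.boolNot)
    (fun a b => ?_) (fun a => ?_) (fun _ => rfl) m u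
  · exact congrArg (fun x => Real.exp (β * x)) (overlap_not_not a b)
  · exact congrArg (fun x => Real.exp (β * x)) (chainEnergy_not s t a)

theorem sum_iterate_halfOp_not (β : ℝ) (s t : Bool) (m : ℕ) :
    ∑ u : Fin N → Bool, (weightedOp (halfKernel β) (halfWeight β (!s) (!t)))^[m] (fun _ => 1) u =
      ∑ u : Fin N → Bool, (weightedOp (halfKernel β) (halfWeight β s t))^[m] (fun _ => 1) u := by
  rw [← (Equiv.piCongrRight fun _ : Fin N => Equiv.boolNot).sum_comp]
  exact Finset.sum_congr rfl fun u _ => iterate_halfOp_not β s t m u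

theorem sum_iterate_halfOp_le {β : ℝ} (hβ : 0 ≤ β) (m : ℕ) :
    ∑ u : Fin N → Bool, (weightedOp (halfKernel β) (halfWeight β false true))^[m] (fun _ => 1) u ≤
      ∑ u : Fin N → Bool, (weightedOp (halfKernel β) (halfWeight β true true))^[m] (fun _ => 1) u := by
  have hK : ∀ a b : Fin N → Bool, 0 ≤ halfKernel β a b := fun _ _ => (Real.exp_pos _).le
  have hw : ∀ s t (a : Fin N → Bool), 0 ≤ halfWeight β s t a := fun _ _ _ => (Real.exp_pos _).le
  have h1 : ∀ a : Fin N → Bool, (0 : ℝ) ≤ (fun _ => 1) a := fun _ => zero_le_one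
  have h0 : ∀ s t (a : Fin N → Bool),
      0 ≤ (weightedOp (halfKernel β) (halfWeight β s t))^[m] (fun _ => 1) a :=
    fun s t => iterate_weightedOp_nonneg hK (hw s t) h1 m
  have h4 := four_functions_theorem_univ _ _ _ _ (h0 false true) (h0 true false) (h0 false false)
    (h0 true true)
    (FourFun.iterate_weightedOp (supermodularKernel_halfKernel hβ) hK
      (fourFun_halfWeight hβ false true true false) (fun _ _ => le_rfl) (hw _ _) (hw _ _) (hw _ _)
      (hw _ _) h1 h1 h1 h1 m)
  simp only [show (false ⊓ true) = false from rfl, show (true ⊓ false) = false from rfl,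
    show (false ⊔ true) = true from rfl, show (true ⊔ false) = true from rfl] at h4
  have e1 := sum_iterate_halfOp_not (N := N) β false true m
  have e2 := sum_iterate_halfOp_not (N := N) β true true m
  rw [Bool.not_false, Bool.not_true] at e1
  rw [Bool.not_true] at e2
  rw [e1, e2, ← sq, ← sq] at h4
  exact (sq_le_sq₀ (Finset.sum_nonneg fun u _ => h0 _ _ u)
    (Finset.sum_nonneg fun u _ => h0 _ _ u)).1 h4

theorem le_of_pow_mul_le {a b c C : ℝ} (hb : 0 < b) (hc : 0 < c)
    (h : ∀ m : ℕ, a ^ m * c ≤ b ^ m * C) : a ≤ b := by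
  by_contra! hab
  obtain ⟨m, hm⟩ := pow_unbounded_of_one_lt (C / c) ((one_lt_div hb).2 hab)
  have := h m
  rw [div_pow, div_lt_div_iff₀ hc (pow_pos hb m)] at hm
  linarith

theorem interface_eigenvalue_le {β lo le : ℝ} (hβ : 0 ≤ β) (hlo : 0 < lo) (hle : 0 < le)
    {φ ψ : (Fin N → Bool) → ℝ} (hφ0 : ∀ u, 0 < φ u) (hψ0 : ∀ u, 0 < ψ u)
    (hφ : ∀ u, weightedOp (halfKernel β) (halfWeight β true true) φ u = le * φ u)
    (hψ : ∀ u, weightedOp (halfKernel β) (halfWeight β false true) ψ u = lo * ψ u) : lo ≤ le := by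
  have hK : ∀ a b : Fin N → Bool, 0 ≤ halfKernel β a b := fun _ _ => (Real.exp_pos _).le
  have hw : ∀ s t (a : Fin N → Bool), 0 ≤ halfWeight β s t a := fun _ _ _ => (Real.exp_pos _).le
  obtain ⟨u₀, hu₀⟩ := Finite.exists_min φ
  obtain ⟨u₁, hu₁⟩ := Finite.exists_max ψ
  refine le_of_pow_mul_le (c := ∑ u, (ψ u₁)⁻¹ * ψ u) (C := ∑ u, (φ u₀)⁻¹ * φ u) hle
    (Finset.sum_pos (fun u _ => mul_pos (inv_pos.2 (hψ0 _)) (hψ0 u)) Finset.univ_nonempty)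
    fun m => ?_
  refine le_trans ?_ ((sum_iterate_halfOp_le (N := N) hβ m).trans ?_)
  · rw [Finset.mul_sum]
    refine Finset.sum_le_sum fun u _ => ?_
    refine le_iterate_weightedOp hK (hw false true) hlo.le (g := fun u => (ψ u₁)⁻¹ * ψ u)
      (fun c => ?_) (fun c => ?_) m u
    · simp only [weightedOp_const_mul, hψ]
      exact (mul_left_comm _ _ _).le
    · rw [inv_mul_le_iff₀ (hψ0 _), mul_one]
      exact hu₁ c
  · rw [Finset.mul_sum]
    refine Finset.sum_le_sum fun u _ => ?_
    refine iterate_weightedOp_le hK (hw true true) hle.le (g := fun u => (φ u₀)⁻¹ * φ u)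
      (fun c => ?_) (fun c => ?_) m u
    · simp only [weightedOp_const_mul, hφ]
      exact (mul_left_comm _ _ _).le
    · rw [le_inv_mul_iff₀ (hφ0 _), mul_one]
      exact hu₀ c

/-- Perron eigenvectors of the half-column transfer operators with pure and with Dobrushin
boundary conditions, with the gap between their eigenvalues. -/
theorem exists_half_eigenvectors {β : ℝ} (hβ0 : 0 ≤ β) (hβ : 3 < Real.exp (2 * β)) (N : ℕ) :
    ∃ (lo le : ℝ) (φ ψ : (Fin N → Bool) → ℝ), 0 < lo ∧ 3 * lo ≤ 2 * le ∧ (∀ u, 0 < φ u) ∧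
      (∀ u, 0 < ψ u) ∧
      (∀ u, weightedOp (halfKernel β) (halfWeight β true true) φ u = le * φ u) ∧
      ∀ u, weightedOp (halfKernel β) (halfWeight β false true) ψ u = lo * ψ u := by
  have hpos : ∀ (s t : Bool) (u v : Fin N → Bool), 0 < halfKernel β u v * halfWeight β s t v :=
    fun _ _ _ _ => mul_pos (Real.exp_pos _) (Real.exp_pos _)
  obtain ⟨le, φ, hle, hφ0, hφ⟩ := exists_pos_eigenvector _ (hpos true true)
  obtain ⟨lo, ψ, hlo, hψ0, hψ⟩ := exists_pos_eigenvector _ (hpos false true)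
  refine ⟨lo, le, φ, ψ, hlo, interface_eigenvalue_gap hβ hφ0 hψ0 hlo
    (interface_eigenvalue_le hβ0 hlo hle hφ0 hψ0 hφ hψ) (fun u => ?_) (fun u => ?_), hφ0, hψ0,
    hφ, hψ⟩
  · simpa only [mul_assoc] using hφ u
  · simpa only [mul_assoc] using hψ u

end EigenvalueComparison

section BlockDecay

variable {α : Type*} [DistribLattice α] [OrderTop α] [Fintype α]

/-- The partition function of `m` columns to the side of a given column, with boundary column `⊤`. -/
def sidePartition (K : α → α → ℝ) (w : α → ℝ) (m : ℕ) : α → ℝ :=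
  (weightedOp K w)^[m] fun c => K c ⊤

theorem sidePartition_add (K : α → α → ℝ) (w : α → ℝ) (m k : ℕ) :
    sidePartition K w (m + k) = (weightedOp K w)^[k] (sidePartition K w m) := by
  rw [sidePartition, add_comm, Function.iterate_add_apply, sidePartition]

variable {K : α → α → ℝ} {w v : α → ℝ}

theorem sidePartition_nonneg (hK : ∀ a b, 0 ≤ K a b) (hw : ∀ a, 0 ≤ w a) (m : ℕ) (c : α) :
    0 ≤ sidePartition K w m c :=
  iterate_weightedOp_nonneg hK hw (fun c => hK c ⊤) m c

theorem fourFun_sidePartition_zero (hKm : SupermodularKernel K) (hK : ∀ a b, 0 ≤ K a b)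
    (hw : ∀ a, 0 ≤ w a) (d : ℕ) :
    FourFun (sidePartition K w d) (sidePartition K w 0) (sidePartition K w d)
      (sidePartition K w 0) := by
  classical
  cases d with
  | zero =>
    intro a b
    simpa [sidePartition] using hKm a b ⊤ ⊤
  | succ d =>
    let p : α → ℝ := fun c => if c = ⊤ then 1 else 0
    let g : α → ℝ := fun c => w c * sidePartition K w d c
    have hp : ∀ c, 0 ≤ p c := fun c => by by_cases h : c = ⊤ <;> simp [p, h]
    have hg : ∀ c, 0 ≤ g c := fun c => mul_nonneg (hw c) (sidePartition_nonneg hK hw d c)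
    have h1 : ∀ c : α, (0 : ℝ) ≤ (fun _ => 1) c := fun _ => zero_le_one
    have hfour : FourFun g p g p := by
      intro a b
      by_cases hb : b = ⊤
      · subst hb
        simp
      · have : p b = 0 := if_neg hb
        rw [this, mul_zero]
        exact mul_nonneg (hg _) (hp _)
    have e1 : sidePartition K w (d + 1) = weightedOp K g fun _ => 1 := by
      rw [sidePartition_add]
      funext c
      exact Finset.sum_congr rfl fun c' _ => by simp only [g]; ring
    have e2 : sidePartition K w 0 = weightedOp K p fun _ => 1 := by
      funext c
      simp [sidePartition, weightedOp, p]
    rw [e1, e2]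
    exact FourFun.weightedOp hKm hK hfour (fun _ _ => le_rfl) hg hp hg hp h1 h1 h1 h1

theorem fourFun_sidePartition (hKm : SupermodularKernel K) (hK : ∀ a b, 0 ≤ K a b)
    (hw : ∀ a, 0 ≤ w a) (hww : FourFun w w w w) {i j : ℕ} (hij : i ≤ j) :
    FourFun (sidePartition K w j) (sidePartition K w i) (sidePartition K w j)
      (sidePartition K w i) := by
  obtain ⟨d, rfl⟩ := Nat.exists_eq_add_of_le' hij
  have e : sidePartition K w i = (weightedOp K w)^[i] (sidePartition K w 0) := by
    rw [← sidePartition_add, zero_add]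
  rw [sidePartition_add, e]
  exact FourFun.iterate_weightedOp hKm hK hww (fourFun_sidePartition_zero hKm hK hw d) hw hw hw hw
    (sidePartition_nonneg hK hw _) (sidePartition_nonneg hK hw _) (sidePartition_nonneg hK hw _)
    (sidePartition_nonneg hK hw _) i

/-- The partition function of a system with `a` columns to the left of a block of `k + 1` columns
of weight `v` and `b` columns to its right. -/
def blockPartition (K : α → α → ℝ) (w v : α → ℝ) (a k b : ℕ) : ℝ :=
  ∑ c, v c * (sidePartition K w a c * (weightedOp K v)^[k] (sidePartition K w b) c)

/-- Enlarging the domain increases the probability of a decreasing block event. -/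
theorem blockPartition_mul_le (hKm : SupermodularKernel K) (hK : ∀ a b, 0 ≤ K a b)
    (hw : ∀ a, 0 ≤ w a) (hv : ∀ a, 0 ≤ v a) (hww : FourFun w w w w) (hwv : FourFun w v v w)
    {a a' b b' : ℕ} (ha : a ≤ a') (hb : b ≤ b') (k : ℕ) :
    blockPartition K w w a' k b' * blockPartition K w v a k b ≤
      blockPartition K w v a' k b' * blockPartition K w w a k b := by
  have hs := sidePartition_nonneg hK hw
  have hi : ∀ {u : α → ℝ}, (∀ a, 0 ≤ u a) → ∀ j c,
      0 ≤ (weightedOp K u)^[k] (sidePartition K w j) c := fun hu j =>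
    iterate_weightedOp_nonneg hK hu (hs j) k
  have hp : ∀ {u : α → ℝ}, (∀ a, 0 ≤ u a) → ∀ i j c,
      0 ≤ sidePartition K w i c * (weightedOp K u)^[k] (sidePartition K w j) c := fun hu i j c =>
    mul_nonneg (hs i c) (hi hu j c)
  refine four_functions_theorem_univ _ _ _ _ (fun c => mul_nonneg (hw c) (hp hw _ _ c))
    (fun c => mul_nonneg (hv c) (hp hv _ _ c)) (fun c => mul_nonneg (hv c) (hp hv _ _ c))
    (fun c => mul_nonneg (hw c) (hp hw _ _ c)) ?_
  refine hwv.mul (.mul (fourFun_sidePartition hKm hK hw hww ha) (FourFun.iterate_weightedOp hKm hK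
    hwv (fourFun_sidePartition hKm hK hw hww hb) hw hv hv hw (hs _) (hs _) (hs _) (hs _) k)
    (hs _) (hs _) (hi hw _) (hi hv _)) hw hv (hp hw _ _) (hp hv _ _)

theorem blockPartition_self_eq (hKs : ∀ c c', K c c' = K c' c) (m l : ℕ) :
    blockPartition K w v m (2 * l) m =
      ∑ c, v c * ((weightedOp K v)^[l] (sidePartition K w m) c) ^ 2 := by
  have h := sum_mul_iterate_weightedOp_comm hKs v (sidePartition K w m)
    ((weightedOp K v)^[l] (sidePartition K w m)) l
  rw [← Function.iterate_add_apply, ← two_mul] at h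
  rw [blockPartition]
  simp only [sq, ← mul_assoc] at h ⊢
  exact h

theorem sum_weight_sidePartition_sq_le {g : α → ℝ} {l : ℝ} (hK : ∀ a b, 0 ≤ K a b)
    (hw : ∀ a, 0 ≤ w a) (hl : 0 ≤ l) (hg0 : ∀ c, 0 ≤ g c) (hg : ∀ c, l * g c ≤ weightedOp K w g c)
    (hgK : ∀ c, g c ≤ K c ⊤) (m : ℕ) :
    (l ^ 2) ^ m * ∑ c, w c * g c ^ 2 ≤ ∑ c, w c * sidePartition K w m c ^ 2 := by
  rw [Finset.mul_sum]
  refine Finset.sum_le_sum fun c _ => ?_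
  have h := le_iterate_weightedOp hK hw hl hg hgK m c
  calc (l ^ 2) ^ m * (w c * g c ^ 2) = w c * (l ^ m * g c) ^ 2 := by ring
    _ ≤ _ := mul_le_mul_of_nonneg_left
      (pow_le_pow_left₀ (mul_nonneg (pow_nonneg hl m) (hg0 c)) h 2) (hw c)

/-- A block of columns of weight `v ≤ w` costs at least the ratio of the corresponding
eigenvalues. -/
theorem blockPartition_le (hKm : SupermodularKernel K) (hKs : ∀ c c', K c c' = K c' c)
    (hK : ∀ a b, 0 < K a b) (hw : ∀ a, 0 < w a) (hv : ∀ a, 0 ≤ v a) (hvw : ∀ a, v a ≤ w a)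
    (hww : FourFun w w w w) (hwv : FourFun w v v w) {ψ g : α → ℝ} {κ l : ℝ} (hκ : 0 < κ)
    (hψ0 : ∀ c, 0 < ψ c) (hψ : ∀ c, v c ≠ 0 → weightedOp K v ψ c = κ * ψ c) (hl : 0 < l)
    (hg0 : ∀ c, 0 ≤ g c) (hgt : 0 < g ⊤) (hg : ∀ c, l * g c ≤ weightedOp K w g c) (a b q : ℕ) :
    (l ^ 2) ^ q * blockPartition K w v a (2 * q) b ≤
      (κ ^ 2) ^ q * blockPartition K w w a (2 * q) b := by
  have hK0 : ∀ a b, 0 ≤ K a b := fun a b => (hK a b).le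
  have hw0 : ∀ a, 0 ≤ w a := fun a => (hw a).le
  have hs := sidePartition_nonneg hK0 hw0
  obtain ⟨ε, hε, hgK⟩ : ∃ ε : ℝ, 0 < ε ∧ ∀ c, ε * g c ≤ K c ⊤ := by
    have : Nonempty α := ⟨⊤⟩
    obtain ⟨x, hx⟩ := Finite.exists_max g
    obtain ⟨y, hy⟩ := Finite.exists_min fun c => K c ⊤
    have hgx : 0 < g x := hgt.trans_le (hx ⊤)
    refine ⟨K y ⊤ / g x, div_pos (hK _ _) hgx, fun c => le_trans ?_ (hy c)⟩
    rw [div_mul_eq_mul_div, div_le_iff₀ hgx]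
    exact mul_le_mul_of_nonneg_left (hx c) (hK0 _ _)
  have hspos : ∀ m c, 0 < sidePartition K w m c := by
    intro m
    induction m with
    | zero => exact fun c => hK c ⊤
    | succ m ih =>
      rw [sidePartition_add]
      exact fun c => Finset.sum_pos (fun c' _ => mul_pos (mul_pos (hK _ _) (hw _)) (ih c')) ⟨⊤, Finset.mem_univ _⟩
  have hZ : 0 < blockPartition K w w a (2 * q) b := by
    rw [blockPartition, ← sidePartition_add]
    exact Finset.sum_pos (fun c _ => mul_pos (hw c) (mul_pos (hspos _ c) (hspos _ c)))
      ⟨⊤, Finset.mem_univ _⟩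
  have hZv : 0 ≤ blockPartition K w v a (2 * q) b :=
    Finset.sum_nonneg fun c _ => mul_nonneg (hv c)
      (mul_nonneg (hs a c) (iterate_weightedOp_nonneg hK0 hv (hs b) _ c))
  let S : ℕ → ℝ := fun m => ∑ c, w c * sidePartition K w m c ^ 2
  have hstep : ∀ m, max a b ≤ m → S (m + q) * blockPartition K w v a (2 * q) b ≤
      ((κ ^ 2) ^ q * blockPartition K w w a (2 * q) b) * S m := by
    intro m hm
    have h := blockPartition_mul_le hKm hK0 hw0 hv hww hwv ((le_max_left a b).trans hm)
      ((le_max_right a b).trans hm) (2 * q)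
    rw [blockPartition_self_eq hKs, blockPartition_self_eq hKs, ← sidePartition_add] at h
    have h2 : ∑ c, v c * ((weightedOp K v)^[q] (sidePartition K w m) c) ^ 2 ≤ (κ ^ 2) ^ q * S m := by
      refine (sum_iterate_weightedOp_sq_le hKs hK0 hv hψ0 hψ _ q).trans ?_
      exact mul_le_mul_of_nonneg_left (Finset.sum_le_sum fun c _ =>
        mul_le_mul_of_nonneg_right (hvw c) (sq_nonneg _)) (by positivity)
    calc _ ≤ _ := h
      _ ≤ (κ ^ 2) ^ q * S m * blockPartition K w w a (2 * q) b :=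
        mul_le_mul_of_nonneg_right h2 hZ.le
      _ = _ := by ring
  have hiter : ∀ t, S (max a b + t * q) * blockPartition K w v a (2 * q) b ^ t ≤
      ((κ ^ 2) ^ q * blockPartition K w w a (2 * q) b) ^ t * S (max a b) := by
    intro t
    induction t with
    | zero => simp
    | succ t ih =>
      have h := hstep (max a b + t * q) (Nat.le_add_right _ _)
      calc S (max a b + (t + 1) * q) * blockPartition K w v a (2 * q) b ^ (t + 1)
          = S (max a b + t * q + q) * blockPartition K w v a (2 * q) b *
              blockPartition K w v a (2 * q) b ^ t := by
            rw [Nat.succ_mul, ← add_assoc, pow_succ]; ring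
        _ ≤ ((κ ^ 2) ^ q * blockPartition K w w a (2 * q) b) * S (max a b + t * q) *
              blockPartition K w v a (2 * q) b ^ t :=
            mul_le_mul_of_nonneg_right h (pow_nonneg hZv t)
        _ = ((κ ^ 2) ^ q * blockPartition K w w a (2 * q) b) *
              (S (max a b + t * q) * blockPartition K w v a (2 * q) b ^ t) := by ring
        _ ≤ ((κ ^ 2) ^ q * blockPartition K w w a (2 * q) b) *
              (((κ ^ 2) ^ q * blockPartition K w w a (2 * q) b) ^ t * S (max a b)) :=
            mul_le_mul_of_nonneg_left ih (by positivity)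
        _ = _ := by rw [pow_succ]; ring
  have hG : 0 < ∑ c, w c * (ε * g c) ^ 2 :=
    Finset.sum_pos' (fun c _ => mul_nonneg (hw0 c) (sq_nonneg _))
      ⟨⊤, Finset.mem_univ _, mul_pos (hw _) (pow_pos (mul_pos hε hgt) 2)⟩
  refine le_of_pow_mul_le (c := (l ^ 2) ^ max a b * ∑ c, w c * (ε * g c) ^ 2) (C := S (max a b))
    (by positivity) (by positivity) fun t => ?_
  have hlow := sum_weight_sidePartition_sq_le (g := fun c => ε * g c) hK0 hw0 hl.le
    (fun c => mul_nonneg hε.le (hg0 c)) (fun c => by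
      rw [weightedOp_const_mul]
      calc l * (ε * g c) = ε * (l * g c) := by ring
        _ ≤ _ := mul_le_mul_of_nonneg_left (hg c) hε.le) hgK (max a b + t * q)
  refine le_trans ?_ (hiter t)
  calc _ = (l ^ 2) ^ (max a b + t * q) * (∑ c, w c * (ε * g c) ^ 2) *
        blockPartition K w v a (2 * q) b ^ t := by
        rw [mul_pow, pow_add, ← pow_mul, mul_comm t q]; ring
    _ ≤ _ := mul_le_mul_of_nonneg_right hlow (pow_nonneg hZv t)

end BlockDecay

section Column

/-- A column of the box: the spin on the axis, the spins above it and the spins below it. -/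
abbrev Column (N : ℕ) : Type := Bool × (Fin N → Bool) × (Fin N → Bool)

variable {N : ℕ}

/-- Energy of a column with plus boundary conditions at both ends. -/
def columnEnergy (c : Column N) : ℝ := chainEnergy c.1 true c.2.1 + chainEnergy c.1 true c.2.2

/-- Interaction energy between two columns. -/
def columnOverlap (c c' : Column N) : ℝ :=
  sval c.1 * sval c'.1 + (overlap c.2.1 c'.2.1 + overlap c.2.2 c'.2.2)

/-- Transfer kernel between consecutive columns. -/
noncomputable def columnKernel (β : ℝ) (c c' : Column N) : ℝ := Real.exp (β * columnOverlap c c')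

/-- Weight of a column. -/
noncomputable def columnWeight (β : ℝ) (c : Column N) : ℝ := Real.exp (β * columnEnergy c)

/-- Weight of a column whose spin on the axis is `s`, and `0` for other columns. -/
noncomputable def axisWeight (β : ℝ) (s : Bool) (c : Column N) : ℝ :=
  if c.1 = s then columnWeight β c else 0

theorem supermodularKernel_columnKernel {β : ℝ} (hβ : 0 ≤ β) :
    SupermodularKernel (columnKernel (N := N) β) := by
  intro a b a' b'
  refine exp_mul_exp_le hβ ?_
  have h1 := sval_mul_add_le a.1 a'.1 b.1 b'.1
  have h2 := overlap_add_le a.2.1 b.2.1 a'.2.1 b'.2.1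
  have h3 := overlap_add_le a.2.2 b.2.2 a'.2.2 b'.2.2
  simp only [columnOverlap, Prod.fst_inf, Prod.snd_inf, Prod.fst_sup, Prod.snd_sup]
  linarith

theorem fourFun_columnWeight {β : ℝ} (hβ : 0 ≤ β) :
    FourFun (columnWeight (N := N) β) (columnWeight β) (columnWeight β) (columnWeight β) := by
  intro a b
  refine exp_mul_exp_le hβ ?_
  have h1 := chainEnergy_add_le a.1 true b.1 true a.2.1 b.2.1
  have h2 := chainEnergy_add_le a.1 true b.1 true a.2.2 b.2.2
  simp only [inf_idem, sup_idem] at h1 h2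
  simp only [columnEnergy, Prod.fst_inf, Prod.snd_inf, Prod.fst_sup, Prod.snd_sup]
  linarith

theorem axisWeight_nonneg (β : ℝ) (s : Bool) (c : Column N) : 0 ≤ axisWeight β s c := by
  rw [axisWeight]
  split_ifs
  exacts [(Real.exp_pos _).le, le_rfl]

theorem axisWeight_le (β : ℝ) (s : Bool) (c : Column N) : axisWeight β s c ≤ columnWeight β c := by
  rw [axisWeight]
  split_ifs
  exacts [le_rfl, (Real.exp_pos _).le]

theorem fourFun_axisWeight {β : ℝ} (hβ : 0 ≤ β) :
    FourFun (columnWeight (N := N) β) (axisWeight β false) (axisWeight β false)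
      (columnWeight β) := by
  intro a b
  by_cases hb : b.1 = false
  · have hab : (a ⊓ b).1 = false := by rw [Prod.fst_inf, hb]; exact inf_bot_eq _
    rw [axisWeight, axisWeight, if_pos hb, if_pos hab]
    exact fourFun_columnWeight hβ a b
  · rw [axisWeight, if_neg hb, mul_zero]
    exact mul_nonneg (axisWeight_nonneg _ _ _) (Real.exp_pos _).le

theorem columnKernel_comm (β : ℝ) (c c' : Column N) : columnKernel β c c' = columnKernel β c' c := by
  rw [columnKernel, columnKernel, columnOverlap, columnOverlap, overlap_comm c.2.1,
    overlap_comm c.2.2, mul_comm (sval c.1)]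

theorem weightedOp_axisWeight (β : ℝ) (s : Bool) (x y : (Fin N → Bool) → ℝ) (c : Column N) :
    weightedOp (columnKernel β) (axisWeight β s) (fun c => x c.2.1 * y c.2.2) c =
      Real.exp (β * (sval c.1 * sval s)) *
        (weightedOp (halfKernel β) (halfWeight β s true) x c.2.1 *
          weightedOp (halfKernel β) (halfWeight β s true) y c.2.2) := by
  have hterm : ∀ u d : Fin N → Bool,
      columnKernel β c (s, u, d) * columnWeight β (s, u, d) * (x u * y d) =
        Real.exp (β * (sval c.1 * sval s)) *
          ((halfKernel β c.2.1 u * halfWeight β s true u * x u) *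
            (halfKernel β c.2.2 d * halfWeight β s true d * y d)) := by
    intro u d
    simp only [columnKernel, columnWeight, halfKernel, halfWeight, columnOverlap, columnEnergy,
      mul_add, Real.exp_add]
    ring
  rw [weightedOp, Fintype.sum_prod_type, Fintype.sum_eq_single s, Fintype.sum_prod_type]
  · simp only [axisWeight, if_true, hterm]
    simp only [← Finset.mul_sum, ← Finset.sum_mul, weightedOp]
  · intro s' hs'
    exact Finset.sum_eq_zero fun p _ => by rw [axisWeight, if_neg hs', mul_zero, zero_mul]

/-- The partition function with a block of `2 q + 1` minus spins on the axis is exponentially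
smaller than the full partition function. -/
theorem blockPartition_axisWeight_le {β : ℝ} (hβ0 : 0 ≤ β) (hβ : 3 < Real.exp (2 * β))
    (N a b q : ℕ) :
    blockPartition (columnKernel (N := N) β) (columnWeight β) (axisWeight β false) a (2 * q) b ≤
      (4 / 9) ^ (2 * q) *
        blockPartition (columnKernel (N := N) β) (columnWeight β) (columnWeight β) a (2 * q) b := by
  obtain ⟨lo, le, φ, ψ, hlo, hgap, hφ0, hψ0, hφ, hψ⟩ := exists_half_eigenvectors hβ0 hβ N
  have hle : 0 < le := by linarith
  have hK : ∀ a b : Column N, 0 < columnKernel β a b := fun _ _ => Real.exp_pos _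
  have hw : ∀ a : Column N, 0 < columnWeight β a := fun _ => Real.exp_pos _
  have hmain := blockPartition_le (supermodularKernel_columnKernel hβ0) (columnKernel_comm β)
    hK hw (axisWeight_nonneg β false) (axisWeight_le β false) (fourFun_columnWeight hβ0)
    (fourFun_axisWeight hβ0) (ψ := fun c => ψ c.2.1 * ψ c.2.2)
    (g := fun c => if c.1 = true then φ c.2.1 * φ c.2.2 else 0) (κ := Real.exp β * lo ^ 2)
    (l := Real.exp β * le ^ 2) (by positivity) (fun c => mul_pos (hψ0 _) (hψ0 _)) ?_
    (by positivity) ?_ (by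
      rw [if_pos (show (⊤ : Column N).1 = true from rfl)]
      exact mul_pos (hφ0 _) (hφ0 _)) ?_ a b q
  · have hZ : 0 ≤ blockPartition (columnKernel (N := N) β) (columnWeight β) (columnWeight β) a
        (2 * q) b := Finset.sum_nonneg fun c _ => mul_nonneg (hw c).le (mul_nonneg
          (sidePartition_nonneg (fun _ _ => (hK _ _).le) (fun _ => (hw _).le) a c)
          (iterate_weightedOp_nonneg (fun _ _ => (hK _ _).le) (fun _ => (hw _).le)
            (sidePartition_nonneg (fun _ _ => (hK _ _).le) (fun _ => (hw _).le) b) _ c))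
    refine le_of_mul_le_mul_left (hmain.trans ?_)
      (show 0 < ((Real.exp β * le ^ 2) ^ 2) ^ q by positivity)
    rw [← mul_assoc]
    refine mul_le_mul_of_nonneg_right ?_ hZ
    rw [pow_mul, ← mul_pow]
    refine pow_le_pow_left₀ (by positivity) ?_ q
    have h1 : lo ^ 2 ≤ 4 / 9 * le ^ 2 := by nlinarith
    calc (Real.exp β * lo ^ 2) ^ 2 ≤ (Real.exp β * (4 / 9 * le ^ 2)) ^ 2 := by gcongr
      _ = _ := by ring
  · intro c hc
    have hc1 : c.1 = false := by
      by_contra h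
      exact hc (if_neg h)
    rw [weightedOp_axisWeight, hψ, hψ, hc1]
    simp [sval]
    ring
  · intro c
    split_ifs
    exacts [(mul_pos (hφ0 _) (hφ0 _)).le, le_rfl]
  · intro c
    have h : weightedOp (columnKernel β) (columnWeight β)
        (fun c : Column N => if c.1 = true then φ c.2.1 * φ c.2.2 else 0) c =
        weightedOp (columnKernel β) (axisWeight β true) (fun c => φ c.2.1 * φ c.2.2) c := by
      refine Finset.sum_congr rfl fun c' _ => ?_
      by_cases hc' : c'.1 = true <;> simp [axisWeight, hc']
    rw [h, weightedOp_axisWeight, hφ, hφ]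
    by_cases hc : c.1 = true
    · rw [if_pos hc, hc]
      refine le_of_eq ?_
      simp [sval]
      ring
    · rw [if_neg hc, mul_zero]
      have := hφ0 c.2.1
      have := hφ0 c.2.2
      positivity

end Column

section PathSum

theorem bordered_cons_succ {α : Type*} {L : ℕ} (s t a : α) (C : Fin L → α) (k : ℕ) :
    bordered s t (Fin.cons a C : Fin (L + 1) → α) (k + 1) = bordered a t C k := by
  cases k with
  | zero => rfl
  | succ k =>
    by_cases h : k < L
    · simp only [bordered, Nat.add_lt_add_iff_right, h, dif_pos]
      exact Fin.cons_succ (α := fun _ => α) a C ⟨k, h⟩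
    · simp [bordered, h]

variable {α : Type*} [Fintype α]

/-- Sum over all `L`-step paths from `s` to `t` of the product of the kernel along the path and of
the weights of the visited points. -/
def pathSum (K : α → α → ℝ) (t : α) (g : ℕ → α → ℝ) (L : ℕ) (s : α) : ℝ :=
  ∑ C : Fin L → α, (∏ k ∈ Finset.range (L + 1), K (bordered s t C k) (bordered s t C (k + 1))) *
    ∏ i : Fin L, g i (C i)

theorem pathSum_zero (K : α → α → ℝ) (t : α) (g : ℕ → α → ℝ) (s : α) : pathSum K t g 0 s = K s t := by
  simp [pathSum, bordered]

theorem pathSum_succ (K : α → α → ℝ) (t : α) (g : ℕ → α → ℝ) (L : ℕ) :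
    pathSum K t g (L + 1) = weightedOp K (g 0) (pathSum K t (fun i => g (i + 1)) L) := by
  funext s
  rw [pathSum, ← (Fin.consEquiv fun _ => α).sum_comp, Fintype.sum_prod_type, weightedOp]
  refine Finset.sum_congr rfl fun a _ => ?_
  rw [pathSum, Finset.mul_sum]
  refine Finset.sum_congr rfl fun C _ => ?_
  change (∏ k ∈ Finset.range (L + 1 + 1), K (bordered s t (Fin.cons a C : Fin (L + 1) → α) k)
    (bordered s t (Fin.cons a C : Fin (L + 1) → α) (k + 1))) *
    ∏ i : Fin (L + 1), g i ((Fin.cons a C : Fin (L + 1) → α) i) = _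
  rw [Finset.prod_range_succ', Fin.prod_univ_succ]
  simp only [bordered_cons_succ, Fin.cons_zero, Fin.cons_succ, Fin.val_zero, Fin.val_succ]
  simp only [bordered]
  ring

theorem pathSum_add (K : α → α → ℝ) (t : α) (w : α → ℝ) (g : ℕ → α → ℝ) (m L : ℕ)
    (hg : ∀ i < m, g i = w) :
    pathSum K t g (m + L) = (weightedOp K w)^[m] (pathSum K t (fun i => g (m + i)) L) := by
  induction m generalizing g with
  | zero => simp
  | succ m ih =>
    rw [show m + 1 + L = m + L + 1 by omega, pathSum_succ, ih _ fun i hi => hg _ (by omega),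
      hg 0 (by omega), Function.iterate_succ_apply']
    simp only [add_right_comm]

theorem iterate_weightedOp_weightedOp_apply {K : α → α → ℝ} (hKs : ∀ c c', K c c' = K c' c)
    (w v f : α → ℝ) (a : ℕ) (t : α) :
    (weightedOp K w)^[a] (weightedOp K v f) t =
      ∑ c, v c * ((weightedOp K w)^[a] (fun c => K c t) c * f c) := by
  cases a with
  | zero =>
    refine Finset.sum_congr rfl fun c _ => ?_
    rw [Function.iterate_zero, id, hKs t c]
    ring
  | succ a =>
    have h := sum_mul_iterate_weightedOp_comm hKs w (fun c => K c t) (weightedOp K v f) a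
    have h1 : (weightedOp K w)^[a + 1] (weightedOp K v f) t =
        ∑ c, w c * K c t * (weightedOp K w)^[a] (weightedOp K v f) c := by
      rw [Function.iterate_succ_apply']
      exact Finset.sum_congr rfl fun c _ => by rw [hKs t c, mul_comm (w c)]
    rw [h1, h, Function.iterate_succ_apply']
    simp only [weightedOp, Finset.mul_sum, Finset.sum_mul]
    rw [Finset.sum_comm]
    refine Finset.sum_congr rfl fun c _ => Finset.sum_congr rfl fun c' _ => ?_
    rw [hKs c c']
    ring

theorem pathSum_block [DistribLattice α] [OrderTop α] {K : α → α → ℝ}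
    (hKs : ∀ c c', K c c' = K c' c) (w v : α → ℝ) (a k b : ℕ) :
    pathSum K ⊤ (fun i => if a ≤ i ∧ i < a + (k + 1) then v else w) (a + ((k + 1) + b)) ⊤ =
      blockPartition K w v a k b := by
  rw [pathSum_add K ⊤ w _ a _ fun i hi => if_neg (by omega),
    pathSum_add K ⊤ v _ (k + 1) b fun i hi => if_pos (by omega), Function.iterate_succ_apply',
    iterate_weightedOp_weightedOp_apply hKs]
  have h : pathSum K ⊤ (fun i => if a ≤ a + (k + 1 + i) ∧ a + (k + 1 + i) < a + (k + 1) then v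
      else w) b = sidePartition K w b := by
    rw [← add_zero b, pathSum_add K ⊤ w _ b 0 fun i hi => if_neg (by omega), sidePartition]
    exact congrArg _ (funext fun s => pathSum_zero _ _ _ _)
  rw [h]
  rfl

end PathSum

section Box

theorem sum_Icc_neg_eq_sum_range (N : ℕ) (F : ℤ → ℝ) :
    ∑ x ∈ Finset.Icc (-(N : ℤ)) N, F x = ∑ k ∈ Finset.range (2 * N + 1), F ((k : ℤ) - N) := by
  refine Finset.sum_bij' (fun x _ => (x + N).toNat) (fun k _ => (k : ℤ) - N) ?_ ?_ ?_ ?_ ?_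
  · intro x hx
    rw [Finset.mem_Icc] at hx
    rw [Finset.mem_range]
    omega
  · intro k hk
    rw [Finset.mem_range] at hk
    rw [Finset.mem_Icc]
    omega
  · intro x hx
    rw [Finset.mem_Icc] at hx
    omega
  · intro k hk
    omega
  · intro x hx
    rw [Finset.mem_Icc] at hx
    congr 1
    omega

theorem sum_range_odd_shift (N : ℕ) (F : ℤ → ℝ) :
    ∑ k ∈ Finset.range (2 * N + 1), F ((k : ℤ) - N) =
      F 0 + (∑ i ∈ Finset.range N, F (i + 1) + ∑ i ∈ Finset.range N, F (-(i : ℤ) - 1)) := by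
  induction N with
  | zero => simp
  | succ N ih =>
    rw [show 2 * (N + 1) + 1 = 2 * N + 1 + 1 + 1 by ring, Finset.sum_range_succ,
      Finset.sum_range_succ', Finset.sum_range_succ _ N, Finset.sum_range_succ _ N]
    have e : ∀ k ∈ Finset.range (2 * N + 1), F (((k + 1 : ℕ) : ℤ) - ((N + 1 : ℕ) : ℤ)) =
        F ((k : ℤ) - N) := fun k _ => by congr 1; push_cast; ring
    rw [Finset.sum_congr rfl e, ih,
      show (((0 : ℕ) : ℤ) - ((N + 1 : ℕ) : ℤ)) = -(N : ℤ) - 1 by push_cast; ring,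
      show (((2 * N + 1 + 1 : ℕ) : ℤ) - ((N + 1 : ℕ) : ℤ)) = (N : ℤ) + 1 by push_cast; ring]
    ring

theorem sum_range_even_shift (M : ℕ) (F : ℤ → ℝ) :
    ∑ k ∈ Finset.range (2 * M), F ((k : ℤ) - M) =
      ∑ i ∈ Finset.range M, F i + ∑ i ∈ Finset.range M, F (-(i : ℤ) - 1) := by
  induction M with
  | zero => simp
  | succ M ih =>
    rw [show 2 * (M + 1) = 2 * M + 1 + 1 by ring, Finset.sum_range_succ,
      Finset.sum_range_succ', Finset.sum_range_succ _ M, Finset.sum_range_succ _ M]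
    have e : ∀ k ∈ Finset.range (2 * M), F (((k + 1 : ℕ) : ℤ) - ((M + 1 : ℕ) : ℤ)) =
        F ((k : ℤ) - M) := fun k _ => by congr 1; push_cast; ring
    rw [Finset.sum_congr rfl e, ih,
      show (((0 : ℕ) : ℤ) - ((M + 1 : ℕ) : ℤ)) = -(M : ℤ) - 1 by push_cast; ring,
      show (((2 * M + 1 : ℕ) : ℤ) - ((M + 1 : ℕ) : ℤ)) = (M : ℤ) by push_cast; ring]
    ring

/-- Half the ordered sum over internal bonds of an interval plus the sum over its boundary bonds
is the sum over all bonds. -/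
theorem sum_bonds (M : ℕ) (g : ℕ → ℝ) :
    (∑ k ∈ Finset.range (M + 1), (if k < M then g (k + 1) else 0) +
        ∑ k ∈ Finset.range (M + 1), (if 0 < k then g k else 0)) / 2 +
      (∑ k ∈ Finset.range (M + 1), (if k < M then 0 else g (k + 1)) +
        ∑ k ∈ Finset.range (M + 1), (if 0 < k then 0 else g k)) =
      ∑ k ∈ Finset.range (M + 2), g k := by
  have e1 : ∑ k ∈ Finset.range (M + 1), (if k < M then g (k + 1) else 0) =
      ∑ k ∈ Finset.range M, g (k + 1) := by
    rw [Finset.sum_range_succ, if_neg (lt_irrefl M), add_zero]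
    exact Finset.sum_congr rfl fun k hk => if_pos (Finset.mem_range.1 hk)
  have e2 : ∑ k ∈ Finset.range (M + 1), (if 0 < k then g k else 0) =
      ∑ k ∈ Finset.range M, g (k + 1) := by
    rw [Finset.sum_range_succ', if_neg (lt_irrefl 0), add_zero]
    exact Finset.sum_congr rfl fun k hk => if_pos (Nat.succ_pos k)
  have e3 : ∑ k ∈ Finset.range (M + 1), (if k < M then 0 else g (k + 1)) = g (M + 1) := by
    rw [Finset.sum_range_succ, if_neg (lt_irrefl M), add_eq_right]
    exact Finset.sum_eq_zero fun k hk => if_pos (Finset.mem_range.1 hk)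
  have e4 : ∑ k ∈ Finset.range (M + 1), (if 0 < k then 0 else g k) = g 0 := by
    rw [Finset.sum_range_succ', if_neg (lt_irrefl 0), add_eq_right]
    exact Finset.sum_eq_zero fun k hk => if_pos (Nat.succ_pos k)
  rw [e1, e2, e3, e4, Finset.sum_range_succ, Finset.sum_range_succ']
  ring

theorem sum_nbrs (x : ℤ × ℤ) (F : ℤ × ℤ → ℝ) :
    ∑ y ∈ nbrs x, F y = F (x.1 + 1, x.2) + F (x.1 - 1, x.2) + (F (x.1, x.2 + 1) + F (x.1, x.2 - 1)) := by
  rw [nbrs, Finset.sum_insert, Finset.sum_insert, Finset.sum_insert, Finset.sum_singleton]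
  · ring
  all_goals
    simp only [Finset.mem_insert, Finset.mem_singleton, Prod.mk.injEq]
    omega

theorem mem_box {N : ℕ} {x : ℤ × ℤ} :
    x ∈ box N ↔ (-(N : ℤ) ≤ x.1 ∧ x.1 ≤ N) ∧ (-(N : ℤ) ≤ x.2 ∧ x.2 ≤ N) := by
  rw [box, Finset.mem_product, Finset.mem_Icc, Finset.mem_Icc]

/-- Product of the spins at the two ends of a bond. -/
def bondSpin (η : Cfg2) (x y : ℤ × ℤ) : ℝ := sval (η x) * sval (η y)

theorem bondSpin_comm (η : Cfg2) (x y : ℤ × ℤ) : bondSpin η x y = bondSpin η y x := mul_comm _ _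

theorem sum_box (N : ℕ) (F : ℤ × ℤ → ℝ) :
    ∑ x ∈ box N, F x = ∑ k ∈ Finset.range (2 * N + 1), ∑ l ∈ Finset.range (2 * N + 1),
      F ((k : ℤ) - N, (l : ℤ) - N) := by
  rw [box, Finset.sum_product, sum_Icc_neg_eq_sum_range]
  exact Finset.sum_congr rfl fun k _ => sum_Icc_neg_eq_sum_range N _

theorem sum_interval_bonds (N : ℕ) (h : ℤ → ℝ) :
    (∑ k ∈ Finset.range (2 * N + 1), (if k < 2 * N then h ((k : ℤ) - N + 1) else 0) +
        ∑ k ∈ Finset.range (2 * N + 1), (if 0 < k then h ((k : ℤ) - N) else 0)) / 2 +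
      (∑ k ∈ Finset.range (2 * N + 1), (if k < 2 * N then 0 else h ((k : ℤ) - N + 1)) +
        ∑ k ∈ Finset.range (2 * N + 1), (if 0 < k then 0 else h ((k : ℤ) - N))) =
      ∑ k ∈ Finset.range (2 * N + 2), h ((k : ℤ) - N) := by
  have e : ∀ k : ℕ, h ((k : ℤ) - N + 1) = h (((k + 1 : ℕ) : ℤ) - N) := fun k => by
    congr 1
    push_cast
    ring
  simp only [e]
  exact sum_bonds (2 * N) fun k => h ((k : ℤ) - N)

theorem sum_rows_add_sum_columns (n : ℕ) {a₁ a₂ a₃ a₄ b₁ b₂ b₃ b₄ : ℕ → ℕ → ℝ} {R C : ℕ → ℝ}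
    (hR : ∀ l ∈ Finset.range n, (∑ k ∈ Finset.range n, a₁ k l + ∑ k ∈ Finset.range n, a₂ k l) / 2 +
      (∑ k ∈ Finset.range n, b₁ k l + ∑ k ∈ Finset.range n, b₂ k l) = R l)
    (hC : ∀ k ∈ Finset.range n, (∑ l ∈ Finset.range n, a₃ k l + ∑ l ∈ Finset.range n, a₄ k l) / 2 +
      (∑ l ∈ Finset.range n, b₃ k l + ∑ l ∈ Finset.range n, b₄ k l) = C k) :
    (∑ k ∈ Finset.range n, ∑ l ∈ Finset.range n, (a₁ k l + a₂ k l + (a₃ k l + a₄ k l))) / 2 +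
      ∑ k ∈ Finset.range n, ∑ l ∈ Finset.range n, (b₁ k l + b₂ k l + (b₃ k l + b₄ k l)) =
      ∑ l ∈ Finset.range n, R l + ∑ k ∈ Finset.range n, C k := by
  rw [← Finset.sum_congr rfl hR, ← Finset.sum_congr rfl hC]
  simp only [Finset.sum_add_distrib, ← Finset.sum_div]
  rw [Finset.sum_comm (f := a₁), Finset.sum_comm (f := a₂), Finset.sum_comm (f := b₁),
    Finset.sum_comm (f := b₂)]
  ring

/-- The energy of a configuration in the box as a sum over horizontal and vertical bonds. -/
theorem box_energy_eq (N : ℕ) (η : Cfg2) :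
    (∑ x ∈ box N, ∑ y ∈ (box N).filter (fun y => y ∈ nbrs x), bondSpin η x y) / 2 +
      ∑ x ∈ box N, ∑ y ∈ (nbrs x).filter (fun y => y ∉ box N), bondSpin η x y =
    ∑ l ∈ Finset.range (2 * N + 1), ∑ k ∈ Finset.range (2 * N + 2),
        bondSpin η ((k : ℤ) - N - 1, (l : ℤ) - N) ((k : ℤ) - N, (l : ℤ) - N) +
      ∑ k ∈ Finset.range (2 * N + 1), ∑ l ∈ Finset.range (2 * N + 2),
        bondSpin η ((k : ℤ) - N, (l : ℤ) - N - 1) ((k : ℤ) - N, (l : ℤ) - N) := by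
  have hin : ∀ x, ∑ y ∈ (box N).filter (fun y => y ∈ nbrs x), bondSpin η x y =
      ∑ y ∈ nbrs x, if y ∈ box N then bondSpin η x y else 0 := by
    intro x
    rw [← Finset.sum_filter]
    refine Finset.sum_congr ?_ fun _ _ => rfl
    ext y
    simp only [Finset.mem_filter, and_comm]
  have hout : ∀ x, ∑ y ∈ (nbrs x).filter (fun y => y ∉ box N), bondSpin η x y =
      ∑ y ∈ nbrs x, if y ∈ box N then 0 else bondSpin η x y := by
    intro x
    rw [Finset.sum_filter]
    exact Finset.sum_congr rfl fun y _ => by split_ifs <;> simp_all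
  simp only [hin, hout, sum_nbrs, sum_box]
  have hle : ∀ k ∈ Finset.range (2 * N + 1), -(N : ℤ) ≤ (k : ℤ) - N ∧ (k : ℤ) - N ≤ N := by
    intro k hk
    rw [Finset.mem_range] at hk
    omega
  have hup : ∀ k : ℕ, (-(N : ℤ) ≤ (k : ℤ) - N + 1 ∧ (k : ℤ) - N + 1 ≤ N) ↔ k < 2 * N := by
    intro k
    omega
  have hdown : ∀ k ∈ Finset.range (2 * N + 1),
      (-(N : ℤ) ≤ (k : ℤ) - N - 1 ∧ (k : ℤ) - N - 1 ≤ N) ↔ 0 < k := by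
    intro k hk
    rw [Finset.mem_range] at hk
    omega
  refine sum_rows_add_sum_columns (2 * N + 1) (fun l hl => ?_) (fun k hk => ?_)
  · refine Eq.trans ?_ (sum_interval_bonds N fun x => bondSpin η (x - 1, (l : ℤ) - N) (x, (l : ℤ) - N))
    congr 1
    · congr 2 <;> refine Finset.sum_congr rfl fun k hk => ?_
      · simp only [mem_box, hup, hle l hl, and_self, and_true, add_sub_cancel_right]
      · simp only [mem_box, hdown k hk, hle l hl, and_self, and_true]
        rw [bondSpin_comm]
    · congr 1 <;> refine Finset.sum_congr rfl fun k hk => ?_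
      · simp only [mem_box, hup, hle l hl, and_self, and_true, add_sub_cancel_right]
      · simp only [mem_box, hdown k hk, hle l hl, and_self, and_true]
        rw [bondSpin_comm]
  · refine Eq.trans ?_ (sum_interval_bonds N fun x => bondSpin η ((k : ℤ) - N, x - 1) ((k : ℤ) - N, x))
    congr 1
    · congr 2 <;> refine Finset.sum_congr rfl fun l hl => ?_
      · simp only [mem_box, hup, hle k hk, and_self, true_and, add_sub_cancel_right]
      · simp only [mem_box, hdown l hl, hle k hk, and_self, true_and]
        rw [bondSpin_comm]
    · congr 1 <;> refine Finset.sum_congr rfl fun l hl => ?_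
      · simp only [mem_box, hup, hle k hk, and_self, true_and, add_sub_cancel_right]
      · simp only [mem_box, hdown l hl, hle k hk, and_self, true_and]
        rw [bondSpin_comm]

end Box

section ColumnConfiguration

variable {N : ℕ}

/-- The spin of a column at height `y`, the column being extended by plus spins. -/
def spinAt (c : Column N) (y : ℤ) : Bool :=
  if 0 ≤ y then bordered c.1 true c.2.1 y.toNat else bordered c.1 true c.2.2 (-y).toNat

/-- The configuration with columns `C` in the box and plus spins outside. -/
def columnsCfg (C : Fin (2 * N + 1) → Column N) : Cfg2 :=
  fun x => spinAt (bordered ⊤ ⊤ C (x.1 + N + 1).toNat) x.2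

theorem spinAt_natCast (c : Column N) (i : ℕ) : spinAt c i = bordered c.1 true c.2.1 i := by
  simp [spinAt]

theorem spinAt_neg_natCast (c : Column N) (i : ℕ) : spinAt c (-(i : ℤ)) = bordered c.1 true c.2.2 i := by
  cases i with
  | zero => simp [spinAt, bordered]
  | succ i =>
    rw [spinAt, if_neg (by omega), neg_neg, Int.toNat_natCast]

theorem spinAt_zero (c : Column N) : spinAt c 0 = c.1 := by
  simp [spinAt, bordered]

theorem spinAt_fin_add_one (c : Column N) (i : Fin N) : spinAt c ((i : ℤ) + 1) = c.2.1 i := by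
  have h := spinAt_natCast c (i + 1)
  rw [bordered_succ] at h
  exact_mod_cast h

theorem spinAt_neg_fin_sub_one (c : Column N) (i : Fin N) : spinAt c (-(i : ℤ) - 1) = c.2.2 i := by
  have h := spinAt_neg_natCast c (i + 1)
  rw [bordered_succ] at h
  rw [← h]
  congr 1
  push_cast
  ring

theorem bordered_of_lt {α : Type*} {M : ℕ} (s t : α) (u : Fin M → α) {i : ℕ} (h : M < i) :
    bordered s t u i = t := by
  cases i with
  | zero => omega
  | succ i => rw [bordered, dif_neg (by omega)]

theorem bordered_self {α : Type*} {M : ℕ} (t : α) (i : ℕ) :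
    bordered t t (fun _ : Fin M => t) i = t := by
  cases i with
  | zero => rfl
  | succ i => by_cases h : i < M <;> simp [bordered, h]

theorem spinAt_top (y : ℤ) : spinAt (⊤ : Column N) y = true := by
  rw [spinAt]
  split_ifs
  exacts [bordered_self true _, bordered_self true _]

theorem columnsCfg_of_notMem (C : Fin (2 * N + 1) → Column N) {x : ℤ × ℤ} (hx : x ∉ box N) :
    columnsCfg C x = true := by
  rw [mem_box] at hx
  by_cases h1 : -(N : ℤ) ≤ x.1 ∧ x.1 ≤ N
  · rw [columnsCfg, spinAt]
    split_ifs with h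
    · exact bordered_of_lt _ _ _ (by omega)
    · exact bordered_of_lt _ _ _ (by omega)
  · have : bordered ⊤ ⊤ C (x.1 + N + 1).toNat = ⊤ := by
      by_cases h2 : x.1 < -(N : ℤ)
      · rw [show (x.1 + N + 1).toNat = 0 by omega, bordered]
      · exact bordered_of_lt _ _ _ (by omega)
    rw [columnsCfg, this, spinAt_top]

theorem columnsCfg_sub (C : Fin (2 * N + 1) → Column N) (k : ℕ) (y : ℤ) :
    columnsCfg C ((k : ℤ) - N, y) = spinAt (bordered ⊤ ⊤ C (k + 1)) y := by
  rw [columnsCfg, show ((k : ℤ) - N + N + 1).toNat = k + 1 by omega]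

theorem columnsCfg_sub_one (C : Fin (2 * N + 1) → Column N) (k : ℕ) (y : ℤ) :
    columnsCfg C ((k : ℤ) - N - 1, y) = spinAt (bordered ⊤ ⊤ C k) y := by
  rw [columnsCfg, show ((k : ℤ) - N - 1 + N + 1).toNat = k by omega]

theorem columnsCfg_fin (C : Fin (2 * N + 1) → Column N) (k : Fin (2 * N + 1)) (y : ℤ) :
    columnsCfg C ((k : ℤ) - N, y) = spinAt (C k) y := by
  rw [columnsCfg_sub, bordered_succ]

/-- Configurations in the box as sequences of columns. -/
noncomputable def columnsEquiv (N : ℕ) : (Fin (2 * N + 1) → Column N) ≃ (↥(box N) → Bool) where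
  toFun C x := columnsCfg C x
  invFun τ k := (fill (box N) (fun _ => true) τ ((k : ℤ) - N, 0),
    fun i => fill (box N) (fun _ => true) τ ((k : ℤ) - N, (i : ℤ) + 1),
    fun i => fill (box N) (fun _ => true) τ ((k : ℤ) - N, -(i : ℤ) - 1))
  left_inv C := by
    have h : fill (box N) (fun _ => true) (fun x : ↥(box N) => columnsCfg C x) = columnsCfg C := by
      funext x
      by_cases hx : x ∈ box N
      · simp [fill, hx]
      · simp [fill, hx, columnsCfg_of_notMem C hx]
    funext k
    simp only [h, columnsCfg_fin, spinAt_zero, spinAt_fin_add_one, spinAt_neg_fin_sub_one]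
  right_inv τ := by
    funext ⟨⟨a, b⟩, hx⟩
    have hm := mem_box.1 hx
    obtain ⟨k, rfl⟩ : ∃ k : Fin (2 * N + 1), (k : ℤ) - N = a :=
      ⟨⟨(a + N).toNat, by simp only at hm; omega⟩, by simp only at hm ⊢; omega⟩
    simp only at hm
    refine (columnsCfg_fin _ k b).trans ?_
    rcases lt_trichotomy b 0 with hb | hb | hb
    · obtain ⟨i, rfl⟩ : ∃ i : Fin N, -(i : ℤ) - 1 = b :=
        ⟨⟨(-b - 1).toNat, by omega⟩, by simp only; omega⟩
      rw [spinAt_neg_fin_sub_one]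
      exact dif_pos hx
    · subst hb
      rw [spinAt_zero]
      exact dif_pos hx
    · obtain ⟨i, rfl⟩ : ∃ i : Fin N, (i : ℤ) + 1 = b :=
        ⟨⟨(b - 1).toNat, by omega⟩, by simp only; omega⟩
      rw [spinAt_fin_add_one]
      exact dif_pos hx

theorem fill_columnsEquiv (C : Fin (2 * N + 1) → Column N) :
    fill (box N) (fun _ => true) (columnsEquiv N C) = columnsCfg C := by
  funext x
  by_cases hx : x ∈ box N
  · exact dif_pos hx
  · rw [columnsCfg_of_notMem C hx]
    exact dif_neg hx

theorem sum_spinAt_mul_spinAt (c c' : Column N) :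
    ∑ l ∈ Finset.range (2 * N + 1), sval (spinAt c ((l : ℤ) - N)) * sval (spinAt c' ((l : ℤ) - N)) =
      columnOverlap c c' := by
  rw [sum_range_odd_shift N fun y => sval (spinAt c y) * sval (spinAt c' y), columnOverlap,
    ← Fin.sum_univ_eq_sum_range fun i : ℕ => sval (spinAt c ((i : ℤ) + 1)) *
      sval (spinAt c' ((i : ℤ) + 1)),
    ← Fin.sum_univ_eq_sum_range fun i : ℕ => sval (spinAt c (-(i : ℤ) - 1)) *
      sval (spinAt c' (-(i : ℤ) - 1))]
  simp only [spinAt_zero, spinAt_fin_add_one, spinAt_neg_fin_sub_one, overlap]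

theorem sum_spinAt_sub_one_mul_spinAt (c : Column N) :
    ∑ l ∈ Finset.range (2 * N + 2),
        sval (spinAt c ((l : ℤ) - N - 1)) * sval (spinAt c ((l : ℤ) - N)) = columnEnergy c := by
  have h := sum_range_even_shift (N + 1) fun y => sval (spinAt c y) * sval (spinAt c (y + 1))
  have e : ∀ l : ℕ, sval (spinAt c ((l : ℤ) - ((N + 1 : ℕ) : ℤ))) *
      sval (spinAt c ((l : ℤ) - ((N + 1 : ℕ) : ℤ) + 1)) =
      sval (spinAt c ((l : ℤ) - N - 1)) * sval (spinAt c ((l : ℤ) - N)) := by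
    intro l
    rw [show (l : ℤ) - ((N + 1 : ℕ) : ℤ) + 1 = (l : ℤ) - N by push_cast; ring,
      show (l : ℤ) - ((N + 1 : ℕ) : ℤ) = (l : ℤ) - N - 1 by push_cast; ring]
  simp only [e] at h
  rw [show 2 * N + 2 = 2 * (N + 1) by ring, h, columnEnergy, chainEnergy, chainEnergy]
  congr 1
  refine Finset.sum_congr rfl fun i _ => ?_
  rw [sub_add_cancel, spinAt_neg_natCast, mul_comm, ← spinAt_neg_natCast c (i + 1),
    show -((i + 1 : ℕ) : ℤ) = -(i : ℤ) - 1 by push_cast; ring]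

theorem isingWeight_columnsCfg (β : ℝ) (C : Fin (2 * N + 1) → Column N) :
    isingWeight β 0 (box N) (fun _ => true) (columnsCfg C) =
      (∏ k ∈ Finset.range (2 * N + 1 + 1),
        columnKernel β (bordered ⊤ ⊤ C k) (bordered ⊤ ⊤ C (k + 1))) *
        ∏ i, columnWeight β (C i) := by
  have hout : ∑ x ∈ box N, ∑ y ∈ (nbrs x).filter (fun y => y ∉ box N),
      sval (columnsCfg C x) * sval true =
      ∑ x ∈ box N, ∑ y ∈ (nbrs x).filter (fun y => y ∉ box N), bondSpin (columnsCfg C) x y := by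
    refine Finset.sum_congr rfl fun x _ => Finset.sum_congr rfl fun y hy => ?_
    rw [bondSpin, columnsCfg_of_notMem C (Finset.mem_filter.1 hy).2]
  have hE := box_energy_eq N (columnsCfg C)
  rw [← hout, Finset.sum_comm] at hE
  simp only [bondSpin, columnsCfg_sub, columnsCfg_sub_one, sum_spinAt_mul_spinAt,
    sum_spinAt_sub_one_mul_spinAt] at hE
  rw [← Fin.sum_univ_eq_sum_range fun k => columnEnergy (bordered ⊤ ⊤ C (k + 1))] at hE
  simp only [bordered_succ] at hE
  rw [isingWeight, zero_mul, sub_zero, hE, mul_add, Real.exp_add, Finset.mul_sum, Finset.mul_sum,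
    Real.exp_sum, Real.exp_sum]
  rfl

end ColumnConfiguration

section FiniteVolume

theorem isingWeight_pos (β h : ℝ) (Λ : Finset (ℤ × ℤ)) (σ ω : Cfg2) : 0 < isingWeight β h Λ σ ω :=
  Real.exp_pos _

open Classical in
theorem isingFV_le_ofReal {β h : ℝ} {Λ : Finset (ℤ × ℤ)} {σ : Cfg2} {A : Set Cfg2}
    (hA : MeasurableSet A) {c : ℝ}
    (hc : ∑ τ : ↥Λ → Bool, (if fill Λ σ τ ∈ A then isingWeight β h Λ σ (fill Λ σ τ) else 0) ≤
      c * ∑ τ : ↥Λ → Bool, isingWeight β h Λ σ (fill Λ σ τ)) :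
    isingFV β h Λ σ A ≤ ENNReal.ofReal c := by
  have hpos := fun τ : ↥Λ → Bool => isingWeight_pos β h Λ σ (fill Λ σ τ)
  have hZ := Finset.sum_pos (fun τ _ => hpos τ) Finset.univ_nonempty
  have hnum : (∑ τ : ↥Λ → Bool, ENNReal.ofReal (isingWeight β h Λ σ (fill Λ σ τ)) •
      Measure.dirac (fill Λ σ τ)) A = ENNReal.ofReal (∑ τ : ↥Λ → Bool,
        if fill Λ σ τ ∈ A then isingWeight β h Λ σ (fill Λ σ τ) else 0) := by
    rw [Measure.finsetSum_apply,
      ENNReal.ofReal_sum_of_nonneg fun τ _ => by split_ifs <;> [exact (hpos τ).le; exact le_rfl]]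
    refine Finset.sum_congr rfl fun τ _ => ?_
    rw [Measure.smul_apply, Measure.dirac_apply' _ hA]
    by_cases hτ : fill Λ σ τ ∈ A <;> simp [hτ]
  rw [isingFV, Measure.smul_apply, hnum, ← ENNReal.ofReal_sum_of_nonneg fun τ _ => (hpos τ).le,
    smul_eq_mul, ← ENNReal.ofReal_inv_of_pos hZ, ← ENNReal.ofReal_mul (inv_nonneg.2 hZ.le)]
  refine ENNReal.ofReal_le_ofReal ?_
  rwa [inv_mul_le_iff₀ hZ, mul_comm]

theorem sum_isingWeight_box (β : ℝ) (N : ℕ) :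
    ∑ τ : ↥(box N) → Bool, isingWeight β 0 (box N) (fun _ => true) (fill (box N) (fun _ => true) τ) =
      pathSum (columnKernel (N := N) β) ⊤ (fun _ => columnWeight β) (2 * N + 1) ⊤ := by
  rw [← (columnsEquiv N).sum_comp, pathSum]
  simp only [fill_columnsEquiv, isingWeight_columnsCfg]

/-- The event that the sites `(-n, 0), …, (-1, 0)` carry minus spins. -/
def minusSegment (n : ℕ) : Set Cfg2 :=
  {η | ∀ x ∈ (Finset.Icc (-(n : ℤ)) (-1)).image fun i : ℤ => ((i, 0) : ℤ × ℤ), η x = false}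

theorem mem_minusSegment {n : ℕ} {η : Cfg2} :
    η ∈ minusSegment n ↔ ∀ i : ℤ, -(n : ℤ) ≤ i → i ≤ -1 → η (i, 0) = false := by
  simp only [minusSegment, Set.mem_ofPred_eq, Finset.forall_mem_image, Finset.mem_Icc, and_imp]

theorem columnsCfg_mem_minusSegment {N n : ℕ} (hn : n ≤ N) (C : Fin (2 * N + 1) → Column N) :
    columnsCfg C ∈ minusSegment n ↔
      ∀ k : Fin (2 * N + 1), N - n ≤ (k : ℕ) ∧ (k : ℕ) < N - n + n → (C k).1 = false := by
  rw [mem_minusSegment]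
  constructor
  · intro h k hk
    rw [← spinAt_zero, ← columnsCfg_fin]
    exact h _ (by omega) (by omega)
  · intro h i h1 h2
    obtain ⟨k, rfl⟩ : ∃ k : Fin (2 * N + 1), (k : ℤ) - N = i :=
      ⟨⟨(i + N).toNat, by omega⟩, by simp only; omega⟩
    rw [columnsCfg_fin, spinAt_zero]
    exact h k (by omega)

open Classical in
theorem sum_isingWeight_minusSegment (β : ℝ) {N n : ℕ} (hn : n ≤ N) :
    ∑ τ : ↥(box N) → Bool, (if fill (box N) (fun _ => true) τ ∈ minusSegment n then
        isingWeight β 0 (box N) (fun _ => true) (fill (box N) (fun _ => true) τ) else 0) =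
      pathSum (columnKernel (N := N) β) ⊤
        (fun i => if N - n ≤ i ∧ i < N - n + n then axisWeight β false else columnWeight β)
        (2 * N + 1) ⊤ := by
  rw [← (columnsEquiv N).sum_comp, pathSum]
  refine Finset.sum_congr rfl fun C _ => ?_
  simp only [fill_columnsEquiv, isingWeight_columnsCfg]
  by_cases hC : columnsCfg C ∈ minusSegment n
  · rw [if_pos hC]
    congr 1
    refine Finset.prod_congr rfl fun k _ => ?_
    split_ifs with hk
    · rw [axisWeight, if_pos ((columnsCfg_mem_minusSegment hn C).1 hC k hk)]
    · rfl
  · rw [if_neg hC]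
    rw [columnsCfg_mem_minusSegment hn C] at hC
    push Not at hC
    obtain ⟨k, hk, hCk⟩ := hC
    rw [Finset.prod_eq_zero (Finset.mem_univ k), mul_zero]
    rw [if_pos hk, axisWeight, if_neg (by simpa using hCk)]

theorem measurableSet_minusSegment (n : ℕ) : MeasurableSet (minusSegment n) := by
  have : minusSegment n = ⋂ i : ℤ, ⋂ _ : -(n : ℤ) ≤ i, ⋂ _ : i ≤ -1, (fun η => η (i, 0)) ⁻¹' {false} := by
    ext η
    simp [mem_minusSegment]
  rw [this]
  exact MeasurableSet.iInter fun i => MeasurableSet.iInter fun _ => MeasurableSet.iInter fun _ =>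
    measurable_pi_apply ((i, 0) : ℤ × ℤ) (measurableSet_singleton false)

theorem isingFV_minusSegment_le {β : ℝ} (hβ0 : 0 ≤ β) (hβ : 3 < Real.exp (2 * β)) {N q : ℕ}
    (hq : 2 * q + 1 ≤ N) :
    isingFV β 0 (box N) (fun _ => true) (minusSegment (2 * q + 1)) ≤
      ENNReal.ofReal ((4 / 9) ^ (2 * q)) := by
  classical
  refine isingFV_le_ofReal (measurableSet_minusSegment _) ?_
  have h := fun w v : Column N → ℝ => pathSum_block (columnKernel_comm (N := N) β) w v
    (N - (2 * q + 1)) (2 * q) (N + 1)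
  rw [show N - (2 * q + 1) + (2 * q + 1 + (N + 1)) = 2 * N + 1 by omega] at h
  have h1 := h (columnWeight β) (columnWeight β)
  simp only [ite_self] at h1
  rw [sum_isingWeight_minusSegment β hq, sum_isingWeight_box, h, h1]
  exact blockPartition_axisWeight_le hβ0 hβ N _ _ q

end FiniteVolume

section PlusPhase

theorem measurable_lineProj : Measurable lineProj :=
  measurable_pi_lambda _ fun i => measurable_pi_apply ((i, 0) : ℤ × ℤ)

theorem measurableSet_allBlock (n : ℕ) (b : Bool) : MeasurableSet (allBlock n b) := by
  have : allBlock n b = ⋂ i : ℤ, ⋂ _ : -(n : ℤ) ≤ i, ⋂ _ : i ≤ -1, (fun η => η i) ⁻¹' {b} := by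
    ext η
    simp [allBlock]
  rw [this]
  exact MeasurableSet.iInter fun i => MeasurableSet.iInter fun _ => MeasurableSet.iInter fun _ =>
    measurable_pi_apply i (measurableSet_singleton b)

theorem schonmann_allBlock (μ : Measure Cfg2) (n : ℕ) :
    schonmann μ (allBlock n false) = μ (minusSegment n) := by
  rw [schonmann, Measure.map_apply measurable_lineProj (measurableSet_allBlock n false)]
  congr 1
  ext η
  exact mem_minusSegment.symm

theorem schonmann_allBlock_odd_le {β : ℝ} (hβ0 : 0 ≤ β) (hβ : 3 < Real.exp (2 * β))
    {μp : Measure Cfg2} (hμp : IsPlusPhase β 0 μp) (q : ℕ) :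
    schonmann μp (allBlock (2 * q + 1) false) ≤ ENNReal.ofReal ((4 / 9) ^ (2 * q)) := by
  rw [schonmann_allBlock]
  refine le_of_tendsto (hμp.2 _ fun _ => false) ?_
  filter_upwards [eventually_ge_atTop (2 * q + 1)] with N hN
  exact isingFV_minusSegment_le hβ0 hβ hN

theorem allBlock_anti {m n : ℕ} (h : m ≤ n) (b : Bool) : allBlock n b ⊆ allBlock m b :=
  fun _ hη i h1 h2 => hη i (by omega) h2

theorem four_ninths_pow_le {q : ℕ} (hq : 6 ≤ q) :
    (4 / 9 : ℝ) ^ (2 * q) ≤ 2⁻¹ ^ (2 * q + 2) := by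
  have h : (64 / 81 : ℝ) ^ q ≤ 1 / 4 :=
    (pow_le_pow_of_le_one (by norm_num) (by norm_num) hq).trans (by norm_num)
  calc (4 / 9 : ℝ) ^ (2 * q) = (64 / 81) ^ q * (2⁻¹) ^ (2 * q) := by
        rw [pow_mul, pow_mul, ← mul_pow]
        norm_num
    _ ≤ 1 / 4 * (2⁻¹) ^ (2 * q) := by gcongr
    _ = 2⁻¹ ^ (2 * q + 2) := by
        rw [pow_add]
        ring

end PlusPhase

/-- For `β > (ln 3)/2` and `h = 0`,
`ν_{β,0}^+(η ≡ −1 on [−n,−1]) ≤ 2^{−n}` for all large `n`. -/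
theorem minus_block_probability_le_half_pow
    (β : ℝ) (hβ : Real.log 3 / 2 < β) (μp : Measure Cfg2) (hμp : IsPlusPhase β 0 μp) :
    ∃ n₀ : ℕ, ∀ n : ℕ, n₀ ≤ n →
      (schonmann μp) (allBlock n false) ≤ (2 : ENNReal)⁻¹ ^ n := by
  have hβ0 : 0 ≤ β := by linarith [Real.log_pos (show (1 : ℝ) < 3 by norm_num)]
  have hβ3 : 3 < Real.exp (2 * β) := (Real.log_lt_iff_lt_exp (by norm_num)).1 (by linarith)
  refine ⟨13, fun n hn => ?_⟩
  obtain ⟨q, hq, h1, h2⟩ : ∃ q, 6 ≤ q ∧ 2 * q + 1 ≤ n ∧ n ≤ 2 * q + 2 := ⟨(n - 1) / 2, by omega⟩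
  calc schonmann μp (allBlock n false) ≤ schonmann μp (allBlock (2 * q + 1) false) :=
        measure_mono (allBlock_anti h1 false)
    _ ≤ ENNReal.ofReal ((4 / 9) ^ (2 * q)) := schonmann_allBlock_odd_le hβ0 hβ3 hμp q
    _ ≤ ENNReal.ofReal (2⁻¹ ^ (2 * q + 2)) := ENNReal.ofReal_le_ofReal (four_ninths_pow_le hq)
    _ = (2 : ENNReal)⁻¹ ^ (2 * q + 2) := by
        rw [ENNReal.ofReal_pow (by norm_num), ENNReal.ofReal_inv_of_pos two_pos, ENNReal.ofReal_ofNat]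
    _ ≤ (2 : ENNReal)⁻¹ ^ n := pow_le_pow_right_of_le_one' (by simp) h2
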